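/- Let A ∈ M_n(ℂ) and let P_A ∈ ℂ[x, y, t] be the determinant of the matrix x·Re A + y·Im A + t·I_n with entries regarded as polynomials in x, y, t. Suppose G is a homogeneous polynomial in x, y, t with real coefficients such that G(0, 0, 1) = 1 and the image of G in ℂ[x, y, t] divides P_A. Let d = deg G. Then there exists a complex symmetric matrix B ∈ M_d(ℂ) (i.e., Bᵀ = B) such that F_B(x, y, t) = G(x, y, t) for all real x, y, t. -/

import Mathlib

open Matrix Complex

noncomputable section

/-- The Hermitian part `Re A = (A + A*)/2` of a complex matrix. -/
def reM {n : ℕ} (A : Matrix (Fin n) (Fin n) ℂ) : Matrix (Fin n) (Fin n) ℂ :=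
  (2⁻¹ : ℂ) • (A + Aᴴ)

/-- The matrix `Im A = (A - A*)/(2i)`. -/
def imM {n : ℕ} (A : Matrix (Fin n) (Fin n) ℂ) : Matrix (Fin n) (Fin n) ℂ :=
  ((2 * Complex.I)⁻¹ : ℂ) • (A - Aᴴ)

/-- The base polynomial of `A`, evaluated at real `(x, y, t)`:
`F_A(x,y,t) = det(x·Re A + y·Im A + t·I)`. -/
def basePoly {n : ℕ} (A : Matrix (Fin n) (Fin n) ℂ) (x y t : ℝ) : ℂ :=
  ((x : ℂ) • reM A + (y : ℂ) • imM A + (t : ℂ) • (1 : Matrix (Fin n) (Fin n) ℂ)).det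

/-- The base polynomial of `A` as a polynomial in the three variables
`x = X 0`, `y = X 1`, `t = X 2`: the determinant of `x·Re A + y·Im A + t·I` with entries
regarded as polynomials. -/
def basePolyMv {n : ℕ} (A : Matrix (Fin n) (Fin n) ℂ) : MvPolynomial (Fin 3) ℂ :=
  Matrix.det (Matrix.of fun i j =>
    MvPolynomial.C (reM A i j) * MvPolynomial.X 0 +
    MvPolynomial.C (imM A i j) * MvPolynomial.X 1 +
    MvPolynomial.C ((1 : Matrix (Fin n) (Fin n) ℂ) i j) * MvPolynomial.X 2)

/-! ### Coefficient spaces -/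

/-- Index set of the non-leading monomials `x^k y^(n-j-k) t^j`, `j < n`. -/
abbrev LIdx (n : ℕ) : Type := Σ j : Fin n, Fin (n - (j : ℕ) + 1)

/-- The coefficient space. -/
abbrev LCoef (n : ℕ) : Type := LIdx n → ℝ

lemma finrank_LCoef_aux (n : ℕ) : ∑ j : Fin n, (n - (j : ℕ) + 1) = n + (n + 1).choose 2 := by
  rw [Fin.sum_univ_eq_sum_range (fun j => n - j + 1) n, ← Finset.sum_range_reflect]
  rw [Finset.sum_congr rfl (g := fun j => (j + 2))]
  · induction n with
    | zero => simp
    | succ n ih =>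
      rw [Finset.sum_range_succ, ih, Nat.choose_succ_succ' (n + 1) 1]
      simp
      omega
  · intro j hj
    have := Finset.mem_range.1 hj
    omega

lemma finrank_LCoef (n : ℕ) : Module.finrank ℝ (LCoef n) = n + (n + 1).choose 2 := by
  rw [Module.finrank_fintype_fun_eq_card, Fintype.card_sigma, ← finrank_LCoef_aux]
  simp

/-- Homogeneous evaluation. -/
def hev {n : ℕ} {A : Type*} [CommRing A] [Algebra ℝ A] (c : LCoef n) (x y t : A) : A :=
  t ^ n + ∑ p : LIdx n, algebraMap ℝ A (c p) * (x ^ (p.2 : ℕ) *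
    y ^ (n - (p.1 : ℕ) - (p.2 : ℕ)) * t ^ (p.1 : ℕ))

/-- The ternary form with the given coefficients. -/
def toMv {n : ℕ} (c : LCoef n) : MvPolynomial (Fin 3) ℝ :=
  hev c (MvPolynomial.X 0) (MvPolynomial.X 1) (MvPolynomial.X 2)

lemma hev_map {n : ℕ} {A B : Type*} [CommRing A] [Algebra ℝ A] [CommRing B] [Algebra ℝ B]
    (φ : A →ₐ[ℝ] B) (c : LCoef n) (x y t : A) :
    φ (hev c x y t) = hev c (φ x) (φ y) (φ t) := by
  simp [hev]

lemma aeval_toMv {n : ℕ} {A : Type*} [CommRing A] [Algebra ℝ A] (c : LCoef n) (x y t : A) :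
    MvPolynomial.aeval ![x, y, t] (toMv c) = hev c x y t := by
  simp [toMv, hev_map]

/-- Exponent vector. -/
def expo (a b c : ℕ) : Fin 3 →₀ ℕ :=
  Finsupp.single 0 a + Finsupp.single 1 b + Finsupp.single 2 c

lemma expo_inj {a b c a' b' c' : ℕ} (h : expo a b c = expo a' b' c') :
    a = a' ∧ b = b' ∧ c = c' := by
  refine ⟨?_, ?_, ?_⟩
  · simpa [expo] using DFunLike.congr_fun h 0
  · simpa [expo] using DFunLike.congr_fun h 1
  · simpa [expo] using DFunLike.congr_fun h 2

lemma eq_expo (d : Fin 3 →₀ ℕ) : d = expo (d 0) (d 1) (d 2) := by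
  ext i; fin_cases i <;> simp [expo]

lemma monomial_expo (a b c : ℕ) :
    (MvPolynomial.X 0 ^ a * MvPolynomial.X 1 ^ b * MvPolynomial.X 2 ^ c :
      MvPolynomial (Fin 3) ℝ) = MvPolynomial.monomial (expo a b c) 1 := by
  simp [MvPolynomial.X_pow_eq_monomial, MvPolynomial.monomial_mul, expo]

/-- Extraction of coefficients. -/
def coefs (n : ℕ) (P : MvPolynomial (Fin 3) ℝ) : LCoef n := fun p =>
  P.coeff (expo p.2 (n - (p.1 : ℕ) - (p.2 : ℕ)) p.1)

lemma coeff_toMv {n : ℕ} (c : LCoef n) (d : Fin 3 →₀ ℕ) :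
    (toMv c).coeff d = (if expo 0 0 n = d then 1 else 0) +
      ∑ p : LIdx n, if expo p.2 (n - (p.1 : ℕ) - (p.2 : ℕ)) p.1 = d then c p else 0 := by
  have h0 : (MvPolynomial.X 2 ^ n : MvPolynomial (Fin 3) ℝ)
      = MvPolynomial.monomial (expo 0 0 n) 1 := by
    rw [← monomial_expo]; simp
  unfold toMv hev
  simp only [monomial_expo, h0, MvPolynomial.algebraMap_eq, MvPolynomial.coeff_add,
    MvPolynomial.coeff_sum, MvPolynomial.coeff_C_mul, MvPolynomial.coeff_monomial]
  simp

lemma coefs_toMv {n : ℕ} (c : LCoef n) : coefs n (toMv c) = c := by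
  ext p
  rw [coefs, coeff_toMv, if_neg, Finset.sum_eq_single p]
  · simp
  · rintro ⟨j, k⟩ - hne
    rw [if_neg]
    intro h
    obtain ⟨h1, h2, h3⟩ := expo_inj h
    apply hne
    obtain ⟨j', k'⟩ := p
    obtain rfl : j = j' := Fin.ext h3
    obtain rfl : k = k' := Fin.ext h1
    rfl
  · simp
  · intro h
    obtain ⟨h1, h2, h3⟩ := expo_inj h
    have := p.1.2
    omega

/-- Homogeneous of degree `n`, monic in `t`. -/
def MonicHom (n : ℕ) (P : MvPolynomial (Fin 3) ℝ) : Prop :=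
  P.IsHomogeneous n ∧ P.coeff (expo 0 0 n) = 1

lemma toMv_coefs {n : ℕ} {P : MvPolynomial (Fin 3) ℝ} (hP : MonicHom n P) :
    toMv (coefs n P) = P := by
  ext d
  rw [coeff_toMv]
  by_cases hd : d 0 + d 1 + d 2 = n
  · by_cases hn : d 2 = n
    · have hd' : d = expo 0 0 n := by
        rw [eq_expo d]
        have h0 : d 0 = 0 := by omega
        have h1 : d 1 = 0 := by omega
        rw [h0, h1, hn]
      rw [if_pos hd'.symm, Finset.sum_eq_zero, hd', hP.2]; · simp
      intro p _
      rw [if_neg]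
      intro h
      rw [hd'] at h
      have := (expo_inj h).2.2
      have := p.1.2
      omega
    · have h2 : d 2 < n := by omega
      rw [if_neg, zero_add]
      · have hk : d 0 < n - d 2 + 1 := by omega
        have hpd : expo (d 0) (n - d 2 - d 0) (d 2) = d := by
          conv_rhs => rw [eq_expo d]
          congr 1
          omega
        rw [Finset.sum_eq_single (⟨⟨d 2, h2⟩, ⟨d 0, hk⟩⟩ : LIdx n)]
        · simp only [coefs, hpd, if_true]
        · rintro ⟨j, k⟩ - hne
          rw [if_neg]
          intro h
          rw [← hpd] at h
          obtain ⟨h1, _, h3⟩ := expo_inj h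
          apply hne
          obtain rfl : j = ⟨d 2, h2⟩ := Fin.ext h3
          obtain rfl : k = ⟨d 0, hk⟩ := Fin.ext h1
          rfl
        · simp
      · intro h
        apply hn
        rw [← h]
        simp [expo]
  · have hz : P.coeff d = 0 := by
      by_contra hne
      apply hd
      have := hP.1 hne
      rw [Finsupp.weight_apply, Finsupp.sum_fintype] at this
      · simpa [Fin.sum_univ_three] using this
      · simp
    rw [hz, if_neg, zero_add]
    · apply Finset.sum_eq_zero
      intro p _
      rw [if_neg]
      rintro rfl
      apply hd
      have h1 := p.1.2
      have h2 := p.2.2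
      simp [expo]
      omega
    · rintro rfl
      apply hd
      simp [expo]

lemma hev_coefs {n : ℕ} {P : MvPolynomial (Fin 3) ℝ} (hP : MonicHom n P)
    {A : Type*} [CommRing A] [Algebra ℝ A] (x y t : A) :
    hev (coefs n P) x y t = MvPolynomial.aeval ![x, y, t] P := by
  rw [← aeval_toMv, toMv_coefs hP]

lemma monicHom_of_eval {n : ℕ} {P : MvPolynomial (Fin 3) ℝ} (hP : P.IsHomogeneous n)
    (h : MvPolynomial.eval ![0, 0, 1] P = 1) : MonicHom n P := by
  refine ⟨hP, ?_⟩
  rw [MvPolynomial.eval_eq'] at h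
  rw [← h, Finset.sum_eq_single (expo 0 0 n)]
  · simp [Fin.prod_univ_three, expo]
  · intro d hd hne
    have hw := hP (MvPolynomial.mem_support_iff.1 hd)
    rw [Finsupp.weight_apply, Finsupp.sum_fintype] at hw
    · have hw : d 0 + d 1 + d 2 = n := by simpa [Fin.sum_univ_three] using hw
      have : ¬ (d 0 = 0 ∧ d 1 = 0) := by
        rintro ⟨h0, h1⟩
        apply hne
        rw [eq_expo d, h0, h1]
        congr 1
        omega
      simp only [Fin.prod_univ_three]
      by_cases h0 : d 0 = 0
      · have h1 : d 1 ≠ 0 := fun h1 => this ⟨h0, h1⟩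
        simp [h1]
      · simp [h0]
    · simp
  · intro hd
    rw [MvPolynomial.notMem_support_iff.1 hd]; simp

lemma hev_injective {n : ℕ} {c c' : LCoef n}
    (h : ∀ x t : ℝ, hev c x 1 t = hev c' x 1 t) : c = c' := by
  have hom : ∀ (c : LCoef n) (l x y t : ℝ), hev c (l * x) (l * y) (l * t) = l ^ n * hev c x y t := by
    intro c l x y t
    simp only [hev, mul_pow, mul_add, Finset.mul_sum]
    congr 1
    refine Finset.sum_congr rfl fun p _ => ?_
    have h1 := p.1.2
    have h2 := p.2.2
    have : l ^ n = l ^ (p.2 : ℕ) * l ^ (n - (p.1 : ℕ) - (p.2 : ℕ)) * l ^ (p.1 : ℕ) := by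
      rw [← pow_add, ← pow_add]; congr 1; omega
    rw [this]; ring
  rw [← coefs_toMv c, ← coefs_toMv c']
  congr 1
  have key : (MvPolynomial.X 1 : MvPolynomial (Fin 3) ℝ) * toMv c = MvPolynomial.X 1 * toMv c' := by
    apply MvPolynomial.funext
    intro v
    have hv : v = ![v 0, v 1, v 2] := by ext i; fin_cases i <;> rfl
    rw [hv]
    simp only [map_mul, MvPolynomial.eval_X]
    rw [← MvPolynomial.coe_aeval_eq_eval, RingHom.coe_coe, aeval_toMv, aeval_toMv]
    by_cases h1 : v 1 = 0
    · simp [h1]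
    · have e0 : v 0 = v 1 * (v 0 / v 1) := by field_simp
      have e2 : v 2 = v 1 * (v 2 / v 1) := by field_simp
      have e1 : v 1 = v 1 * 1 := by ring
      have := h (v 0 / v 1) (v 2 / v 1)
      have h3 := hom c (v 1) (v 0 / v 1) 1 (v 2 / v 1)
      have h4 := hom c' (v 1) (v 0 / v 1) 1 (v 2 / v 1)
      rw [← e0, ← e1, ← e2] at h3 h4
      rw [h3, h4, this]
  exact mul_left_cancel₀ (MvPolynomial.X_ne_zero 1) key

/-! ### Smooth dependence of coefficients -/

/-- All coefficients depend analytically on the parameter. -/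
def SmC {E : Type*} [NormedAddCommGroup E] [NormedSpace ℝ E]
    (F : E → MvPolynomial (Fin 3) ℝ) : Prop :=
  ∀ d, ContDiff ℝ ⊤ fun e => (F e).coeff d

section SmC
variable {E : Type*} [NormedAddCommGroup E] [NormedSpace ℝ E]
  {F G : E → MvPolynomial (Fin 3) ℝ}

lemma SmC.const (P : MvPolynomial (Fin 3) ℝ) : SmC fun _ : E => P := fun _ => contDiff_const

lemma SmC.add (hF : SmC F) (hG : SmC G) : SmC fun e => F e + G e := fun d => by
  simpa using (hF d).add (hG d)

lemma SmC.mul (hF : SmC F) (hG : SmC G) : SmC fun e => F e * G e := fun d => by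
  simp only [MvPolynomial.coeff_mul]
  exact ContDiff.sum fun p _ => (hF _).mul (hG _)

lemma SmC.sum {ι : Type*} {s : Finset ι} {H : ι → E → MvPolynomial (Fin 3) ℝ}
    (h : ∀ i ∈ s, SmC (H i)) : SmC fun e => ∑ i ∈ s, H i e := fun d => by
  simp only [MvPolynomial.coeff_sum]
  exact ContDiff.sum fun p hp => h p hp _

lemma SmC.prod {ι : Type*} {s : Finset ι} {H : ι → E → MvPolynomial (Fin 3) ℝ}
    (h : ∀ i ∈ s, SmC (H i)) : SmC fun e => ∏ i ∈ s, H i e := by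
  classical
  induction s using Finset.induction_on with
  | empty => simpa using SmC.const 1
  | insert a s ha ih =>
    simp only [Finset.prod_insert ha]
    exact (h a (by simp)).mul (ih fun i hi => h i (by simp [hi]))

lemma SmC.C {f : E → ℝ} (hf : ContDiff ℝ ⊤ f) : SmC fun e => MvPolynomial.C (f e) := fun d => by
  simp only [MvPolynomial.coeff_C]
  split_ifs
  · exact hf
  · exact contDiff_const

lemma SmC.toMv {n : ℕ} {f : E → LCoef n} (hf : ContDiff ℝ ⊤ f) : SmC fun e => toMv (f e) := by
  unfold _root_.toMv hev
  refine (SmC.const _).add (SmC.sum fun p _ => SmC.mul ?_ (SmC.const _))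
  exact SmC.C (contDiff_pi.1 hf p)

lemma SmC.coefs (n : ℕ) (hF : SmC F) : ContDiff ℝ ⊤ fun e => coefs n (F e) :=
  contDiff_pi.2 fun _ => hF _

lemma SmC.det {m : ℕ} {H : E → Matrix (Fin m) (Fin m) (MvPolynomial (Fin 3) ℝ)}
    (h : ∀ i j, SmC fun e => H e i j) : SmC fun e => (H e).det := by
  simp only [Matrix.det_apply']
  refine SmC.sum fun σ _ => SmC.mul (SmC.const _) (SmC.prod fun i _ => h _ _)

end SmC

/-! ### Linear pencils without elementary divisors -/

lemma pencil_poly {κ ι : Type*} [Fintype κ] [Fintype ι]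
    (A0 A1 : Matrix κ ι ℂ) (b0 b1 : κ → ℂ)
    (hinj : ∀ z : ℂ, ∀ v : ι → ℂ, (A0 + z • A1) *ᵥ v = 0 → v = 0)
    (hinf : ∀ v : ι → ℂ, A1 *ᵥ v = 0 → v = 0) :
    ∀ (N : ℕ) (q : Polynomial ℂ), q.natDegree = N → q ≠ 0 → ∀ k : ι → Polynomial ℂ,
    (∀ i, ∑ j, (Polynomial.C (A0 i j) + Polynomial.X * Polynomial.C (A1 i j)) * k j
        = q * (Polynomial.C (b0 i) + Polynomial.X * Polynomial.C (b1 i))) →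
    ∃ v, A0 *ᵥ v = b0 ∧ A1 *ᵥ v = b1 := by
  intro N
  induction N with
  | zero =>
    intro q hq hq0 k hk
    obtain ⟨a, rfl⟩ := Polynomial.natDegree_eq_zero.1 hq
    have ha : a ≠ 0 := by rintro rfl; simp at hq0
    -- all coefficients of positive index vanish
    have hco : ∀ (e : ℕ) i, ∑ j, (A0 i j * (k j).coeff (e + 1) + A1 i j * (k j).coeff e)
        = if e = 0 then a * b1 i else 0 := by
      intro e i
      have := congrArg (fun P => Polynomial.coeff P (e + 1)) (hk i)
      simp only [Polynomial.finsetSum_coeff, add_mul, Polynomial.coeff_add,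
        Polynomial.coeff_C_mul, mul_assoc, Polynomial.coeff_X_mul, mul_add] at this
      rw [this]
      rcases e with _ | e <;> simp [Polynomial.coeff_C]
    have hco0 : ∀ i, ∑ j, A0 i j * (k j).coeff 0 = a * b0 i := by
      intro i
      have := congrArg (fun P => Polynomial.coeff P 0) (hk i)
      simpa [Polynomial.finsetSum_coeff, add_mul, Polynomial.coeff_C_mul, mul_assoc,
        mul_add] using this
    obtain ⟨B, hB⟩ : ∃ B : ℕ, ∀ j, (k j).natDegree < B := by
      refine ⟨(Finset.univ.sup fun j => (k j).natDegree) + 1, fun j => ?_⟩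
      exact Nat.lt_succ_of_le (Finset.le_sup (f := fun j => (k j).natDegree) (Finset.mem_univ j))
    have hz : ∀ m e, B ≤ e + m → 1 ≤ e → ∀ j, (k j).coeff e = 0 := by
      intro m
      induction m with
      | zero =>
        intro e he _ j
        exact Polynomial.coeff_eq_zero_of_natDegree_lt (by have := hB j; omega)
      | succ m ih =>
        intro e he h1 j
        have h2 := ih (e + 1) (by omega) (by omega)
        have : (fun j => (k j).coeff e) = 0 := by
          apply hinf
          ext i
          have := hco e i
          rw [if_neg (by omega)] at this
          simpa [h2, Matrix.mulVec, dotProduct] using this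
        exact congrFun this j
    refine ⟨fun j => a⁻¹ * (k j).coeff 0, ?_, ?_⟩
    · ext i
      have := hco0 i
      simp only [Matrix.mulVec, dotProduct]
      rw [← mul_right_inj' ha, Finset.mul_sum, ← this]
      refine Finset.sum_congr rfl fun j _ => ?_
      field_simp
    · ext i
      have := hco 0 i
      have h1 : ∀ j, (k j).coeff 1 = 0 := hz B 1 (by omega) le_rfl
      simp only [zero_add, h1, mul_zero, if_true] at this
      simp only [Matrix.mulVec, dotProduct]
      rw [← mul_right_inj' ha, Finset.mul_sum, ← this]
      refine Finset.sum_congr rfl fun j _ => ?_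
      field_simp
  | succ N ih =>
    intro q hq hq0 k hk
    obtain ⟨z, hz⟩ := IsAlgClosed.exists_root q (by
      intro h
      rw [Polynomial.degree_eq_natDegree hq0, hq] at h
      norm_cast at h)
    have hkz : (fun j => (k j).eval z) = 0 := by
      apply hinj z
      ext i
      have := congrArg (Polynomial.eval z) (hk i)
      simp only [Polynomial.eval_finsetSum, Polynomial.eval_mul, Polynomial.eval_add,
        Polynomial.eval_C, Polynomial.eval_X, hz.eq_zero, zero_mul] at this
      simpa [Matrix.mulVec, dotProduct] using this
    have hdvd : ∀ j, ∃ k', k j = (Polynomial.X - Polynomial.C z) * k' := fun j =>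
      Polynomial.dvd_iff_isRoot.2 (congrFun hkz j)
    choose k' hk' using hdvd
    obtain ⟨q', hq'⟩ := Polynomial.dvd_iff_isRoot.2 hz
    have hXz : (Polynomial.X - Polynomial.C z : Polynomial ℂ) ≠ 0 := Polynomial.X_sub_C_ne_zero z
    have hq'0 : q' ≠ 0 := by rintro rfl; simp at hq'; exact hq0 hq'
    refine ih q' ?_ hq'0 k' ?_
    · rw [hq', Polynomial.natDegree_mul hXz hq'0, Polynomial.natDegree_X_sub_C] at hq
      omega
    · intro i
      apply mul_left_cancel₀ hXz
      have := hk i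
      rw [hq', mul_assoc] at this
      rw [← this, Finset.mul_sum]
      refine Finset.sum_congr rfl fun j _ => ?_
      rw [hk' j]; ring

lemma eval_mulVec_poly {α β : Type*} [Fintype β] (z : ℂ) (M : Matrix α β (Polynomial ℂ))
    (w : β → Polynomial ℂ) (a : α) :
    ((M *ᵥ w) a).eval z = (M.map (Polynomial.eval z) *ᵥ fun b => (w b).eval z) a := by
  simp [Matrix.mulVec, dotProduct, Polynomial.eval_finsetSum]

lemma pencil_matrix {κ ι : Type*} [Fintype κ] [Fintype ι] [DecidableEq κ] [DecidableEq ι]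
    (A0 A1 : Matrix κ ι ℂ) (b0 b1 : κ → ℂ)
    (hinj : ∀ z : ℂ, ∀ v : ι → ℂ, (A0 + z • A1) *ᵥ v = 0 → v = 0)
    (hinf : ∀ v : ι → ℂ, A1 *ᵥ v = 0 → v = 0)
    (hsol : {z : ℂ | ∃ v, (A0 + z • A1) *ᵥ v = b0 + z • b1}.Infinite) :
    ∃ v, A0 *ᵥ v = b0 ∧ A1 *ᵥ v = b1 := by
  obtain ⟨C, hC⟩ : ∃ C : Matrix ι κ ℂ, C * A0 = 1 := by
    have hA : LinearMap.ker (Matrix.toLin' A0) = ⊥ := by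
      rw [LinearMap.ker_eq_bot']
      intro v hv
      apply hinj 0 v
      simpa using hv
    obtain ⟨g, hg⟩ := LinearMap.exists_leftInverse_of_injective _ hA
    refine ⟨LinearMap.toMatrix' g, ?_⟩
    have : LinearMap.toMatrix' (g ∘ₗ Matrix.toLin' A0) = 1 := by rw [hg]; simp
    rwa [LinearMap.toMatrix'_comp, LinearMap.toMatrix'_toLin'] at this
  let cc : ℂ →+* Polynomial ℂ := Polynomial.C
  let PA : Matrix κ ι (Polynomial ℂ) := A0.map cc + (Polynomial.X : Polynomial ℂ) • A1.map cc
  let Pb : κ → Polynomial ℂ := fun i => Polynomial.C (b0 i) + Polynomial.X * Polynomial.C (b1 i)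
  let G : Matrix ι ι (Polynomial ℂ) := C.map cc * PA
  let q := G.det
  let k := G.adjugate *ᵥ (C.map cc *ᵥ Pb)
  have evA : ∀ z, PA.map (Polynomial.eval z) = A0 + z • A1 := by
    intro z; ext i j; simp only [PA, cc, Matrix.map_apply, Matrix.add_apply, Matrix.smul_apply, smul_eq_mul, Polynomial.eval_add, Polynomial.eval_mul, Polynomial.eval_X, Polynomial.eval_C]
  have evb : ∀ z i, (Pb i).eval z = (b0 + z • b1) i := by
    intro z i; simp only [Pb, Pi.add_apply, Pi.smul_apply, smul_eq_mul, Polynomial.eval_add, Polynomial.eval_mul, Polynomial.eval_X, Polynomial.eval_C]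
  have evG : ∀ z, G.map (Polynomial.eval z) = C * (A0 + z • A1) := by
    intro z
    have : G.map (Polynomial.evalRingHom z) =
      (C.map cc).map (Polynomial.evalRingHom z) * PA.map (Polynomial.evalRingHom z) := Matrix.map_mul
    rw [Polynomial.coe_evalRingHom, evA] at this
    rw [this]
    congr 1
    ext i j; simp [cc]
  have hq0 : q ≠ 0 := by
    intro h
    have h1 : (Polynomial.evalRingHom (0 : ℂ)) G.det = 0 := by
      change (Polynomial.evalRingHom (0 : ℂ)) q = 0
      rw [h]; simp
    rw [RingHom.map_det, RingHom.mapMatrix_apply, Polynomial.coe_evalRingHom, evG] at h1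
    simp [hC] at h1
  refine pencil_poly A0 A1 b0 b1 hinj hinf _ q rfl hq0 k ?_
  have hinf' : ∀ z v, (A0 + z • A1) *ᵥ v = b0 + z • b1 →
      ∀ i, (PA *ᵥ k) i - q * Pb i ∈ {P : Polynomial ℂ | P.eval z = 0} := by
    intro z v hv i
    have hb : (fun i => (Pb i).eval z) = (A0 + z • A1) *ᵥ v := by
      rw [hv]; ext i; exact evb z i
    have hadj : G.adjugate.map (Polynomial.eval z) = (C * (A0 + z • A1)).adjugate := by
      rw [← evG]
      exact RingHom.map_adjugate (Polynomial.evalRingHom z) G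
    have hqz : q.eval z = (C * (A0 + z • A1)).det := by
      rw [← evG]
      exact RingHom.map_det (Polynomial.evalRingHom z) G
    have hCm : (C.map cc).map (Polynomial.eval z) = C := by ext i j; simp [cc]
    have hk : (fun j => (k j).eval z) = q.eval z • v := by
      ext j
      simp only [k]
      rw [eval_mulVec_poly, hadj]
      have : (fun b => ((C.map cc *ᵥ Pb) b).eval z) = (C * (A0 + z • A1)) *ᵥ v := by
        ext b
        rw [eval_mulVec_poly, hCm, hb, Matrix.mulVec_mulVec]
      rw [this, Matrix.mulVec_mulVec, Matrix.adjugate_mul, hqz]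
      simp [Matrix.smul_mulVec]
    simp only [Set.mem_ofPred_eq, Polynomial.eval_sub, Polynomial.eval_mul]
    rw [eval_mulVec_poly, evA, hk, Matrix.mulVec_smul]
    have := congrFun hb i
    rw [this]
    simp
  intro i
  have hzero : (PA *ᵥ k) i - q * Pb i = 0 := by
    apply Polynomial.eq_zero_of_infinite_isRoot
    apply hsol.mono
    rintro z ⟨v, hv⟩
    exact hinf' z v hv i
  rw [sub_eq_zero] at hzero
  rw [← hzero]
  simp [PA, cc, Matrix.mulVec, dotProduct]

lemma pencil {E F : Type*} [AddCommGroup E] [Module ℂ E] [FiniteDimensional ℂ E]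
    [AddCommGroup F] [Module ℂ F] [FiniteDimensional ℂ F]
    (A0 A1 : E →ₗ[ℂ] F) (b0 b1 : F)
    (hinj : ∀ z : ℂ, ∀ v, A0 v + z • A1 v = 0 → v = 0)
    (hinf : ∀ v, A1 v = 0 → v = 0)
    (hsol : {z : ℂ | ∃ v, A0 v + z • A1 v = b0 + z • b1}.Infinite) :
    ∃ v, A0 v = b0 ∧ A1 v = b1 := by
  let bE := Module.finBasis ℂ E
  let bF := Module.finBasis ℂ F
  have hm : ∀ (A : E →ₗ[ℂ] F) (v : E), LinearMap.toMatrix bE bF A *ᵥ bE.equivFun v = bF.equivFun (A v) :=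
    fun A v => LinearMap.toMatrix_mulVec_repr bE bF A v
  have hm' : ∀ (A : E →ₗ[ℂ] F) (w : _ → ℂ), LinearMap.toMatrix bE bF A *ᵥ w
      = bF.equivFun (A (bE.equivFun.symm w)) := by
    intro A w
    rw [← hm, LinearEquiv.apply_symm_apply]
  suffices h : ∃ w, LinearMap.toMatrix bE bF A0 *ᵥ w = bF.equivFun b0 ∧
      LinearMap.toMatrix bE bF A1 *ᵥ w = bF.equivFun b1 by
    obtain ⟨w, h0, h1⟩ := h
    refine ⟨bE.equivFun.symm w, ?_, ?_⟩
    · rw [hm'] at h0; exact bF.equivFun.injective h0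
    · rw [hm'] at h1; exact bF.equivFun.injective h1
  apply pencil_matrix
  · intro z w hw
    rw [Matrix.add_mulVec, Matrix.smul_mulVec, hm', hm', ← map_smul, ← map_add] at hw
    exact (LinearEquiv.map_eq_zero_iff _).1 (hinj z _ ((LinearEquiv.map_eq_zero_iff _).1 hw))
  · intro w hw
    rw [hm'] at hw
    exact (LinearEquiv.map_eq_zero_iff _).1 (hinf _ ((LinearEquiv.map_eq_zero_iff _).1 hw))
  · apply hsol.mono
    rintro z ⟨v, hv⟩
    refine ⟨bE.equivFun v, ?_⟩
    rw [Matrix.add_mulVec, Matrix.smul_mulVec, hm, hm, ← map_smul, ← map_add, hv]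
    simp

/-- Skew-symmetric matrices. -/
def skewM (n : ℕ) : Submodule ℂ (Matrix (Fin n) (Fin n) ℂ) where
  carrier := {X | Xᵀ = -X}
  add_mem' := by
    intro a b ha hb
    simp only [Set.mem_ofPred_eq] at *
    rw [Matrix.transpose_add, ha, hb]; abel
  zero_mem' := by simp
  smul_mem' := by
    intro c X hX
    simp only [Set.mem_ofPred_eq] at *
    rw [Matrix.transpose_smul, hX]; simp

lemma mem_skewM {n : ℕ} {X : Matrix (Fin n) (Fin n) ℂ} : X ∈ skewM n ↔ Xᵀ = -X := Iff.rfl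

/-- A skew matrix commuting with a symmetric non-derogatory one vanishes. -/
lemma skew_commute {n : ℕ} (L K : Matrix (Fin n) (Fin n) ℂ) (hL : Lᵀ = L) (hK : Kᵀ = -K)
    (hKL : K * L = L * K)
    (hP : ∀ t : ℂ, ∀ B : Matrix (Fin n) (Fin n) ℂ, Bᵀ = -B →
      B * (L + t • (1 : Matrix (Fin n) (Fin n) ℂ)) = 0 → B = 0) : K = 0 := by
  let A0 : skewM n →ₗ[ℂ] Matrix (Fin n) (Fin n) ℂ :=
    (LinearMap.mulRight ℂ L) ∘ₗ (skewM n).subtype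
  suffices h : ∃ v, A0 v = K ∧ (skewM n).subtype v = 0 by
    obtain ⟨v, h0, h1⟩ := h
    have : v = 0 := by ext1; simpa using h1
    rw [← h0, this]; simp
  apply pencil
  · rintro t ⟨B, hB⟩ h
    ext1
    apply hP t B hB
    simpa [A0, mul_add] using h
  · intro v hv
    ext1; simpa using hv
  · -- all but finitely many `t`
    have hfin : {t : ℂ | (L + t • (1 : Matrix (Fin n) (Fin n) ℂ)).det = 0}.Finite := by
      have : (-L).charpoly ≠ 0 := (Matrix.charpoly_monic _).ne_zero
      refine (Polynomial.finite_setOfPred_isRoot this).subset ?_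
      intro t ht
      simp only [Set.mem_ofPred_eq, Polynomial.IsRoot] at *
      rw [Matrix.eval_charpoly, ← ht, sub_neg_eq_add, add_comm]
      congr 2
      ext i j; simp [Matrix.one_apply, Matrix.diagonal_apply]
    refine hfin.infinite_compl.mono ?_
    intro t ht
    simp only [Set.mem_compl_iff, Set.mem_ofPred_eq] at ht
    set T := L + t • (1 : Matrix (Fin n) (Fin n) ℂ) with hT
    have hTu : IsUnit T.det := isUnit_iff_ne_zero.2 ht
    have hTt : Tᵀ = T := by rw [hT, Matrix.transpose_add, hL]; simp
    have hKT : K * T = T * K := by rw [hT, mul_add, add_mul, hKL]; simp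
    have hKi : K * T⁻¹ = T⁻¹ * K := by
      calc K * T⁻¹ = T⁻¹ * T * K * T⁻¹ := by rw [Matrix.nonsing_inv_mul _ hTu, one_mul]
        _ = T⁻¹ * (T * K) * T⁻¹ := by simp only [mul_assoc]
        _ = T⁻¹ * (K * T) * T⁻¹ := by rw [hKT]
        _ = T⁻¹ * K * (T * T⁻¹) := by simp only [mul_assoc]
        _ = T⁻¹ * K := by rw [Matrix.mul_nonsing_inv _ hTu, mul_one]
    refine ⟨⟨K * T⁻¹, ?_⟩, ?_⟩
    · rw [mem_skewM, Matrix.transpose_mul, Matrix.transpose_nonsing_inv, hTt, hK, hKi]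
      simp
    · have : K * T⁻¹ * T = K := by rw [mul_assoc, Matrix.nonsing_inv_mul _ hTu, mul_one]
      simp only [A0, LinearMap.comp_apply, Submodule.subtype_apply, LinearMap.mulRight_apply,
        smul_zero, add_zero]
      have h2 : K * T⁻¹ * (L + t • (1 : Matrix (Fin n) (Fin n) ℂ)) = K := by rw [← hT]; exact this
      rw [mul_add] at h2
      simpa using h2

/-! ### Jacobi's formula and coranks -/

lemma derivative_det_col {K : Type*} [CommRing K] {n : ℕ} (P : Matrix (Fin n) (Fin n) (Polynomial K)) :
    Polynomial.derivative P.det =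
      ∑ l, (P.updateCol l fun i => Polynomial.derivative (P i l)).det := by
  simp only [Matrix.det_apply', Polynomial.derivative_sum]
  rw [Finset.sum_comm]
  refine Finset.sum_congr rfl fun σ _ => ?_
  rw [← Finset.mul_sum, Polynomial.derivative_intCast_mul, Polynomial.derivative_prod_finset]
  congr 1
  refine Finset.sum_congr rfl fun l _ => ?_
  rw [← Finset.mul_prod_erase Finset.univ _ (Finset.mem_univ l), mul_comm]
  congr 1
  · simp
  · refine Finset.prod_congr rfl fun i hi => ?_
    rw [Matrix.updateCol_ne (Finset.ne_of_mem_erase hi)]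

lemma derivative_det_row {K : Type*} [CommRing K] {n : ℕ} (P : Matrix (Fin n) (Fin n) (Polynomial K)) :
    Polynomial.derivative P.det =
      ∑ l, (P.updateRow l fun i => Polynomial.derivative (P l i)).det := by
  rw [← Matrix.det_transpose, derivative_det_col]
  refine Finset.sum_congr rfl fun l _ => ?_
  rw [← Matrix.det_transpose, Matrix.updateCol_transpose, Matrix.transpose_transpose]
  rfl

/-- If `B` is a nonzero skew matrix with `B * M = 0`, all row replacements of `M` are singular. -/
lemma det_updateRow_of_skew {K : Type*} [Field K] {n : ℕ} {M B : Matrix (Fin n) (Fin n) K}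
    (hB : Bᵀ = -B) (hB0 : B ≠ 0) (hd : ∀ i, B i i = 0) (hBM : B * M = 0) (l : Fin n) (r : Fin n → K) :
    (M.updateRow l r).det = 0 := by
  have hsk : ∀ i j, B j i = - B i j := fun i j => by
    have := congrFun (congrFun hB i) j
    simpa using this
  -- a nonzero `w` with `w l = 0` and `w ᵥ* M = 0`
  obtain ⟨w, hw0, hwl, hwM⟩ : ∃ w : Fin n → K, w ≠ 0 ∧ w l = 0 ∧ w ᵥ* M = 0 := by
    have hrow : ∀ i, B i ᵥ* M = 0 := fun i => by
      have := congrFun hBM i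
      ext j
      simpa [Matrix.vecMul, Matrix.mul_apply, dotProduct] using congrFun this j
    by_cases h : ∃ i, B i ≠ 0 ∧ B i l = 0
    · obtain ⟨i, h1, h2⟩ := h
      exact ⟨B i, h1, h2, hrow i⟩
    · push Not at h
      obtain ⟨i, j, hij⟩ : ∃ i j, B i j ≠ 0 := by
        by_contra hcon
        push Not at hcon
        exact hB0 (by ext i j; exact hcon i j)
      have hil : B i l ≠ 0 := h i (fun h0 => hij (by rw [h0]; rfl))
      have hlBl : B l ≠ 0 := fun h0 => hil (by rw [hsk, h0]; simp)
      exact absurd (hd l) (h l hlBl)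
  rw [← Matrix.exists_vecMul_eq_zero_iff]
  refine ⟨w, hw0, ?_⟩
  rw [← hwM]
  ext j
  simp only [Matrix.vecMul, dotProduct]
  refine Finset.sum_congr rfl fun i _ => ?_
  by_cases hi : i = l
  · subst hi; simp [hwl]
  · rw [Matrix.updateRow_ne hi]

lemma skew_diag {K : Type*} [Field K] [CharZero K] {n : ℕ} {B : Matrix (Fin n) (Fin n) K}
    (hB : Bᵀ = -B) (i : Fin n) : B i i = 0 := by
  have := congrFun (congrFun hB i) i
  simp only [Matrix.transpose_apply, Matrix.neg_apply] at this
  exact self_eq_neg.1 this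

/-- Polynomial whose values are `det (M + ε N)`. -/
def dpoly {K : Type*} [CommRing K] {n : ℕ} (M N : Matrix (Fin n) (Fin n) K) : Polynomial K :=
  (Matrix.of fun i j => Polynomial.C (M i j) + Polynomial.X * Polynomial.C (N i j)).det

lemma eval_dpoly {K : Type*} [CommRing K] {n : ℕ} (M N : Matrix (Fin n) (Fin n) K) (ε : K) :
    (dpoly M N).eval ε = (M + ε • N).det := by
  rw [dpoly, ← Polynomial.coe_evalRingHom, RingHom.map_det]
  congr 1
  ext i j; simp [mul_comm ε]

lemma eval_derivative_dpoly {K : Type*} [CommRing K] {n : ℕ} (M N : Matrix (Fin n) (Fin n) K) (ε : K) :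
    (Polynomial.derivative (dpoly M N)).eval ε = ∑ l, ((M + ε • N).updateRow l (N l)).det := by
  rw [dpoly, derivative_det_row, Polynomial.eval_finsetSum]
  refine Finset.sum_congr rfl fun l _ => ?_
  rw [← Polynomial.coe_evalRingHom, RingHom.map_det]
  congr 1
  ext i j
  by_cases hi : i = l
  · subst hi; simp
  · simp [Matrix.updateRow_ne hi, mul_comm ε]

lemma sum_updateRow_diagonal {K : Type*} [CommRing K] {n : ℕ} (μ : Fin n → K)
    (N : Matrix (Fin n) (Fin n) K) :
    ∑ l, ((Matrix.diagonal μ).updateRow l (N l)).det = ∑ l, (∏ j ∈ Finset.univ.erase l, μ j) * N l l := by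
  refine Finset.sum_congr rfl fun l _ => ?_
  rw [← Matrix.cramer_transpose_apply, Matrix.cramer_eq_adjugate_mulVec, Matrix.diagonal_transpose,
    Matrix.adjugate_diagonal, Matrix.mulVec_diagonal]

/-! ### The determinantal map -/

/-- Parameter space: a diagonal matrix and a symmetric matrix. -/
abbrev ESp (n : ℕ) : Type := (Fin n → ℝ) × (Sym2 (Fin n) → ℝ)

lemma finrank_ESp (n : ℕ) : Module.finrank ℝ (ESp n) = n + (n + 1).choose 2 := by
  rw [Module.finrank_prod, Module.finrank_fintype_fun_eq_card, Module.finrank_fintype_fun_eq_card,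
    Sym2.card, Fintype.card_fin]

/-- Symmetric matrix from its entries. -/
def symM {n : ℕ} (z : Sym2 (Fin n) → ℝ) : Matrix (Fin n) (Fin n) ℝ := Matrix.of fun i j => z s(i, j)

lemma symM_transpose {n : ℕ} (z : Sym2 (Fin n) → ℝ) : (symM z)ᵀ = symM z := by
  ext i j; simp [symM, Sym2.eq_swap]

/-- The linear matrix pencil. -/
def lmat {n : ℕ} {A : Type*} [CommRing A] [Algebra ℝ A] (e : ESp n) (x y t : A) :
    Matrix (Fin n) (Fin n) A :=
  x • (Matrix.diagonal e.1).map (algebraMap ℝ A) + y • (symM e.2).map (algebraMap ℝ A) + t • 1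

lemma lmat_apply {n : ℕ} {A : Type*} [CommRing A] [Algebra ℝ A] (e : ESp n) (x y t : A)
    (i j : Fin n) : lmat e x y t i j = x * algebraMap ℝ A (Matrix.diagonal e.1 i j) +
      y * algebraMap ℝ A (symM e.2 i j) + t * algebraMap ℝ A ((1 : Matrix (Fin n) (Fin n) ℝ) i j) := by
  by_cases h : i = j
  · subst h; simp [lmat]
  · simp [lmat, h]

lemma lmat_real {n : ℕ} (e : ESp n) (x y t : ℝ) :
    lmat e x y t = x • Matrix.diagonal e.1 + y • symM e.2 + t • 1 := by
  ext i j; simp [lmat]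

/-- The generic determinant. -/
def phiMv {n : ℕ} (e : ESp n) : MvPolynomial (Fin 3) ℝ :=
  (lmat e (MvPolynomial.X 0) (MvPolynomial.X 1) (MvPolynomial.X 2)).det

/-- The determinantal map. -/
def Phi {n : ℕ} (e : ESp n) : LCoef n := coefs n (phiMv e)

lemma aeval_phiMv {n : ℕ} {A : Type*} [CommRing A] [Algebra ℝ A] (e : ESp n) (x y t : A) :
    MvPolynomial.aeval ![x, y, t] (phiMv e) = (lmat e x y t).det := by
  rw [phiMv, AlgHom.map_det]
  congr 1
  ext i j
  rw [AlgHom.mapMatrix_apply, Matrix.map_apply, lmat_apply, lmat_apply]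
  simp

lemma monicHom_phiMv {n : ℕ} (e : ESp n) : MonicHom n (phiMv e) := by
  apply monicHom_of_eval
  · rw [phiMv, Matrix.det_apply']
    apply MvPolynomial.IsHomogeneous.sum
    intro σ _
    have h1 : (((Equiv.Perm.sign σ : ℤ) : MvPolynomial (Fin 3) ℝ)).IsHomogeneous 0 := by
      rw [← map_intCast (MvPolynomial.C : ℝ →+* MvPolynomial (Fin 3) ℝ)]
      exact MvPolynomial.isHomogeneous_C _ _
    have h2 : (∏ i, lmat e (MvPolynomial.X 0) (MvPolynomial.X 1) (MvPolynomial.X 2) (σ i) i :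
        MvPolynomial (Fin 3) ℝ).IsHomogeneous (∑ i : Fin n, 1) := by
      apply MvPolynomial.IsHomogeneous.prod
      intro i _
      have hX : ∀ (k : Fin 3) (a : ℝ), (MvPolynomial.X k * MvPolynomial.C a :
          MvPolynomial (Fin 3) ℝ).IsHomogeneous 1 := fun k a =>
        (MvPolynomial.isHomogeneous_X ℝ k).mul (MvPolynomial.isHomogeneous_C _ a)
      have : lmat e (MvPolynomial.X 0) (MvPolynomial.X 1) (MvPolynomial.X 2) (σ i) i =
        (MvPolynomial.X 0 * MvPolynomial.C (Matrix.diagonal e.1 (σ i) i) +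
        MvPolynomial.X 1 * MvPolynomial.C (symM e.2 (σ i) i) + MvPolynomial.X 2 *
        MvPolynomial.C ((1 : Matrix (Fin n) (Fin n) ℝ) (σ i) i) : MvPolynomial (Fin 3) ℝ) := by
        rw [lmat_apply]; rfl
      rw [this]
      exact ((hX _ _).add (hX _ _)).add (hX _ _)
    simpa using h1.mul h2
  · have := aeval_phiMv e (0 : ℝ) 0 1
    rw [MvPolynomial.aeval_eq_eval] at this
    change (MvPolynomial.eval ![0, 0, 1]) (phiMv e) = _ at this
    rw [this]; simp [lmat]

lemma hev_Phi {n : ℕ} {A : Type*} [CommRing A] [Algebra ℝ A] (e : ESp n) (x y t : A) :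
    hev (Phi e) x y t = (lmat e x y t).det := by
  rw [Phi, hev_coefs (monicHom_phiMv e), aeval_phiMv]

lemma contDiff_Phi (n : ℕ) : ContDiff ℝ ⊤ (Phi : ESp n → LCoef n) := by
  apply SmC.coefs
  apply SmC.det
  intro i j
  have : ∀ e : ESp n, lmat e (MvPolynomial.X 0) (MvPolynomial.X 1) (MvPolynomial.X 2) i j =
        (MvPolynomial.X 0 * MvPolynomial.C (Matrix.diagonal e.1 i j) +
        MvPolynomial.X 1 * MvPolynomial.C (symM e.2 i j) + MvPolynomial.X 2 *
        MvPolynomial.C ((1 : Matrix (Fin n) (Fin n) ℝ) i j) : MvPolynomial (Fin 3) ℝ) := by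
        intro e
        rw [lmat_apply]; rfl
  simp only [this]
  refine SmC.add (SmC.add (SmC.mul (SmC.const _) (SmC.C ?_)) (SmC.mul (SmC.const _) (SmC.C ?_))) (SmC.const _)
  · by_cases h : i = j
    · subst h; simp only [Matrix.diagonal_apply_eq]; fun_prop
    · simp only [Matrix.diagonal_apply_ne _ h]; fun_prop
  · simp only [symM, Matrix.of_apply]; fun_prop

/-! ### Injectivity of the differential at good points -/

lemma spectral_real {n : ℕ} {L : Matrix (Fin n) (Fin n) ℝ} (hL : Lᵀ = L) :
    ∃ (O : Matrix (Fin n) (Fin n) ℝ) (μ : Fin n → ℝ), Oᵀ * O = 1 ∧ O * Oᵀ = 1 ∧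
      L = O * Matrix.diagonal μ * Oᵀ := by
  have hH : L.IsHermitian := by
    rw [Matrix.IsHermitian, Matrix.conjTranspose_eq_transpose_of_trivial, hL]
  refine ⟨hH.eigenvectorUnitary, hH.eigenvalues, ?_, ?_, ?_⟩
  · have := Unitary.coe_star_mul_self hH.eigenvectorUnitary
    rwa [Matrix.star_eq_conjTranspose, Matrix.conjTranspose_eq_transpose_of_trivial] at this
  · have := Unitary.coe_mul_star_self hH.eigenvectorUnitary
    rwa [Unitary.coe_star, Matrix.star_eq_conjTranspose, Matrix.conjTranspose_eq_transpose_of_trivial] at this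
  · have := hH.spectral_theorem
    rwa [Unitary.conjStarAlgAut_apply, Matrix.star_eq_conjTranspose,
      Matrix.conjTranspose_eq_transpose_of_trivial] at this

lemma exists_skew_comm {n : ℕ} (L N : Matrix (Fin n) (Fin n) ℝ) (hL : Lᵀ = L) (hN : Nᵀ = N)
    (hP : ∀ t : ℝ, ∀ B : Matrix (Fin n) (Fin n) ℝ, Bᵀ = -B →
      B * (L + t • (1 : Matrix (Fin n) (Fin n) ℝ)) = 0 → B = 0)
    (hdet : ∀ t : ℝ, ∑ l, ((L + t • (1 : Matrix (Fin n) (Fin n) ℝ)).updateRow l (N l)).det = 0) :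
    ∃ K : Matrix (Fin n) (Fin n) ℝ, Kᵀ = -K ∧ K * L - L * K = N := by
  obtain ⟨O, μ, hO1, hO2, hLO⟩ := spectral_real hL
  have hL1 : ∀ t : ℝ, L + t • (1 : Matrix (Fin n) (Fin n) ℝ) =
      O * Matrix.diagonal (fun i => μ i + t) * Oᵀ := by
    intro t
    have : Matrix.diagonal (fun i => μ i + t) = Matrix.diagonal μ + t • (1 : Matrix (Fin n) (Fin n) ℝ) := by
      ext i j; by_cases h : i = j
      · subst h; simp
      · simp [h]
    rw [this, mul_add, add_mul, ← hLO]
    simp [hO2]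
  have hinj : Function.Injective μ := by
    intro i j hij
    by_contra hne
    let Q : Matrix (Fin n) (Fin n) ℝ := Matrix.single i j 1 - Matrix.single j i 1
    have hQ : Qᵀ = -Q := by simp [Q]
    have h := hP (-μ i) (O * Q * Oᵀ) (by
      rw [Matrix.transpose_mul, Matrix.transpose_mul, Matrix.transpose_transpose, hQ]
      simp [mul_assoc]) (by
      rw [hL1]
      have : Q * Matrix.diagonal (fun k => μ k + -μ i) = 0 := by
        ext a b
        simp only [Matrix.mul_diagonal, Q, Matrix.sub_apply, Matrix.zero_apply, Matrix.single_apply]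
        by_cases h1 : j = b
        · subst h1; simp [hij]
        · by_cases h2 : i = b
          · subst h2; simp
          · simp [h1, h2]
      calc O * Q * Oᵀ * (O * Matrix.diagonal (fun k => μ k + -μ i) * Oᵀ)
          = O * Q * (Oᵀ * O) * Matrix.diagonal (fun k => μ k + -μ i) * Oᵀ := by simp only [mul_assoc]
        _ = O * (Q * Matrix.diagonal (fun k => μ k + -μ i)) * Oᵀ := by
            rw [hO1]; simp only [mul_assoc, one_mul]
        _ = 0 := by rw [this]; simp)
    have hQ0 : Q = 0 := by
      calc Q = (Oᵀ * O) * Q * (Oᵀ * O) := by rw [hO1]; simp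
        _ = Oᵀ * (O * Q * Oᵀ) * O := by simp only [mul_assoc]
        _ = 0 := by rw [h]; simp
    have := congrFun (congrFun hQ0 i) j
    simp [Q, Matrix.single_apply, hne, Ne.symm hne] at this
  set N' := Oᵀ * N * O with hN'
  have hdp : ∀ t : ℝ, dpoly (L + t • (1 : Matrix (Fin n) (Fin n) ℝ)) N =
      dpoly (Matrix.diagonal (fun i => μ i + t)) N' := by
    intro t
    apply Polynomial.funext
    intro ε
    rw [eval_dpoly, eval_dpoly, hL1]
    have hNO : N = O * N' * Oᵀ := by
      calc N = (O * Oᵀ) * N * (O * Oᵀ) := by rw [hO2]; simp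
        _ = O * N' * Oᵀ := by rw [hN']; simp only [mul_assoc]
    have : O * Matrix.diagonal (fun i => μ i + t) * Oᵀ + ε • N =
        O * (Matrix.diagonal (fun i => μ i + t) + ε • N') * Oᵀ := by
      conv_lhs => rw [hNO]
      rw [mul_add, add_mul]; simp
    rw [this, Matrix.det_mul, Matrix.det_mul, mul_right_comm, ← Matrix.det_mul, hO2]
    simp
  have hzero : ∀ i, N' i i = 0 := by
    intro i
    have h1 := eval_derivative_dpoly (L + (-μ i) • (1 : Matrix (Fin n) (Fin n) ℝ)) N 0
    rw [zero_smul, add_zero, hdet, hdp, eval_derivative_dpoly, zero_smul, add_zero,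
      sum_updateRow_diagonal, Finset.sum_eq_single i] at h1
    · rcases mul_eq_zero.1 h1 with h | h
      · rw [Finset.prod_eq_zero_iff] at h
        obtain ⟨j, hj, h⟩ := h
        exact absurd (hinj (by linarith : μ j = μ i)) (Finset.ne_of_mem_erase hj)
      · exact h
    · intro l _ hl
      rw [Finset.prod_eq_zero (i := i)]
      · simp
      · simp [Ne.symm hl]
      · simp
    · simp
  have hNt : ∀ i j, N' i j = N' j i := by
    intro i j
    have : N'ᵀ = N' := by
      rw [hN', Matrix.transpose_mul, Matrix.transpose_mul, hN, Matrix.transpose_transpose, mul_assoc]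
    exact congrFun (congrFun this j) i
  let K' : Matrix (Fin n) (Fin n) ℝ := Matrix.of fun i j => N' i j / (μ j - μ i)
  have hK' : K'ᵀ = -K' := by
    ext i j
    simp only [K', Matrix.transpose_apply, Matrix.of_apply, Matrix.neg_apply]
    rw [hNt j i, ← div_neg, neg_sub]
  have hKN : K' * Matrix.diagonal μ - Matrix.diagonal μ * K' = N' := by
    ext i j
    simp only [Matrix.sub_apply, Matrix.mul_diagonal, Matrix.diagonal_mul, K', Matrix.of_apply]
    by_cases h : i = j
    · subst h; simp [hzero]
    · have : μ j - μ i ≠ 0 := fun h' => h (hinj (by linarith))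
      field_simp
  refine ⟨O * K' * Oᵀ, ?_, ?_⟩
  · rw [Matrix.transpose_mul, Matrix.transpose_mul, Matrix.transpose_transpose, hK']
    simp [mul_assoc]
  · calc O * K' * Oᵀ * L - L * (O * K' * Oᵀ)
        = O * K' * (Oᵀ * O) * Matrix.diagonal μ * Oᵀ - O * Matrix.diagonal μ * (Oᵀ * O) * K' * Oᵀ := by
          rw [hLO]; simp only [mul_assoc]
      _ = O * (K' * Matrix.diagonal μ - Matrix.diagonal μ * K') * Oᵀ := by
          rw [hO1]; simp only [mul_assoc, one_mul, mul_sub, sub_mul]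
      _ = (O * Oᵀ) * N * (O * Oᵀ) := by rw [hKN, hN']; simp only [mul_assoc]
      _ = N := by rw [hO2]; simp

/-- Good parameters. -/
def Good {n : ℕ} (e : ESp n) : Prop :=
  Function.Injective e.1 ∧ ∀ z t : ℂ, ∀ B : Matrix (Fin n) (Fin n) ℂ, Bᵀ = -B →
    B * lmat e z 1 t = 0 → B = 0

lemma fderiv_Phi_ker {n : ℕ} {e v : ESp n} (hv : fderiv ℝ Phi e v = 0) (x y t : ℝ) :
    ∑ l, ((lmat e x y t).updateRow l ((x • Matrix.diagonal v.1 + y • symM v.2) l)).det = 0 := by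
  set N := x • Matrix.diagonal v.1 + y • symM v.2 with hN
  have hl : ∀ ε : ℝ, lmat (e + ε • v) x y t = lmat e x y t + ε • N := by
    intro ε
    ext i j
    by_cases h : i = j
    · subst h; simp [lmat, hN, symM]; ring
    · simp [lmat, hN, symM, h]; ring
  have h1 : HasDerivAt (fun ε : ℝ => e + ε • v) v 0 := by
    simpa using ((hasDerivAt_id (0 : ℝ)).smul_const v).const_add e
  have h2 : HasFDerivAt (Phi : ESp n → LCoef n) (fderiv ℝ Phi e) (e + (0 : ℝ) • v) := by
    rw [zero_smul, add_zero]
    exact ((contDiff_Phi n).differentiable (by simp) e).hasFDerivAt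
  have h3 : HasDerivAt (fun ε : ℝ => Phi (e + ε • v)) 0 0 := by
    have := h2.comp_hasDerivAt 0 h1
    rwa [hv] at this
  have h4 : HasDerivAt (fun ε : ℝ => hev (Phi (e + ε • v)) x y t) 0 0 := by
    unfold hev
    have h5 : ∀ p, HasDerivAt (fun ε : ℝ => Phi (e + ε • v) p) 0 0 := hasDerivAt_pi.1 h3
    have := (HasDerivAt.fun_sum (u := Finset.univ) fun p _ => (h5 p).mul_const (x ^ (p.2 : ℕ) *
      y ^ (n - (p.1 : ℕ) - (p.2 : ℕ)) * t ^ (p.1 : ℕ))).const_add (t ^ n)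
    simpa using this
  have h5 : HasDerivAt (fun ε : ℝ => (dpoly (lmat e x y t) N).eval ε)
      ((Polynomial.derivative (dpoly (lmat e x y t) N)).eval 0) 0 := Polynomial.hasDerivAt _ _
  have h6 : (fun ε : ℝ => hev (Phi (e + ε • v)) x y t) = fun ε : ℝ => (dpoly (lmat e x y t) N).eval ε := by
    ext ε
    rw [eval_dpoly, hev_Phi, hl]
  rw [h6] at h4
  have := h5.unique h4
  rw [eval_derivative_dpoly] at this
  simpa using this

lemma map_lmat {n : ℕ} (e : ESp n) (x y t : ℝ) :
    (lmat e x y t).map (algebraMap ℝ ℂ) = lmat e (x : ℂ) (y : ℂ) (t : ℂ) := by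
  ext i j
  rw [Matrix.map_apply, lmat_apply, lmat_apply]; simp

lemma Good.injective_fderiv {n : ℕ} {e : ESp n} (he : Good e) :
    Function.Injective (fderiv ℝ Phi e) := by
  rw [injective_iff_map_eq_zero]
  intro v hv
  have hJ := fderiv_Phi_ker hv
  let cc := algebraMap ℝ ℂ
  let DC : Matrix (Fin n) (Fin n) ℂ := (Matrix.diagonal e.1).map cc
  let SC : Matrix (Fin n) (Fin n) ℂ := (symM e.2).map cc
  have hlm : ∀ z t : ℂ, lmat e z 1 t = SC + z • DC + t • 1 := by
    intro z t
    simp only [lmat, DC, SC, one_smul, cc]; abel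
  have hoff : ∀ X : Matrix (Fin n) (Fin n) ℂ, Xᵀ = -X → (∀ i j, i ≠ j → (X * DC - DC * X) i j = 0) →
      X = 0 := by
    intro X hX h
    ext i j
    by_cases hij : i = j
    · subst hij; exact skew_diag hX i
    · have h1 := h i j hij
      have hDC : DC = Matrix.diagonal (fun i => (e.1 i : ℂ)) := by
        simp only [DC, cc]; rw [Matrix.diagonal_map (by simp)]; rfl
      rw [hDC, Matrix.sub_apply, Matrix.mul_diagonal, Matrix.diagonal_mul] at h1
      have h2 : ((e.1 j : ℂ) - e.1 i) ≠ 0 := by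
        rw [sub_ne_zero]
        intro h3
        exact hij (he.1 (by exact_mod_cast h3.symm))
      have h3 : X i j * ((e.1 j : ℂ) - e.1 i) = 0 := by rw [← h1]; ring
      simpa [h2] using h3
  let comm (Y : Matrix (Fin n) (Fin n) ℂ) : skewM n →ₗ[ℂ] Matrix (Fin n) (Fin n) ℂ :=
    (LinearMap.mulRight ℂ Y - LinearMap.mulLeft ℂ Y) ∘ₗ (skewM n).subtype
  have hcomm : ∀ Y X, comm Y X = X.1 * Y - Y * X.1 := fun Y X => by simp [comm]
  obtain ⟨K, h0, h1⟩ := pencil (comm SC) (comm DC) ((symM v.2).map cc) ((Matrix.diagonal v.1).map cc)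
    (by
      rintro z ⟨X, hX⟩ h
      ext1
      rw [mem_skewM] at hX
      apply skew_commute (SC + z • DC) X _ hX
      · rw [hcomm, hcomm] at h
        simp only [smul_sub] at h
        rw [mul_add, add_mul, mul_smul_comm, smul_mul_assoc, ← sub_eq_zero, ← h]
        abel
      · intro t B hB hBL
        apply he.2 z t B hB
        rwa [hlm]
      · have : SCᵀ = SC := by simp only [SC]; rw [← Matrix.transpose_map, symM_transpose]
        rw [Matrix.transpose_add, this, Matrix.transpose_smul]
        simp [DC])
    (by
      rintro ⟨X, hX⟩ h
      ext1
      rw [hcomm] at h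
      exact hoff X hX fun i j _ => by rw [h]; rfl)
    (by
      refine (Set.infinite_range_of_injective Complex.ofReal_injective).mono ?_
      rintro _ ⟨z, rfl⟩
      have hlr : ∀ t, lmat e z 1 t = (z • Matrix.diagonal e.1 + symM e.2) + t • 1 := by
        intro t; rw [lmat_real, one_smul]
      obtain ⟨K, hK, hKN⟩ := exists_skew_comm (z • Matrix.diagonal e.1 + symM e.2)
        (z • Matrix.diagonal v.1 + symM v.2)
        (by rw [Matrix.transpose_add, symM_transpose]; simp)
        (by rw [Matrix.transpose_add, symM_transpose]; simp)
        (by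
          intro t B hB h
          rw [← hlr] at h
          have hz := he.2 z t (B.map cc) (by
            rw [← Matrix.transpose_map, hB]; ext i j; simp) (by
            have := congrArg (fun M : Matrix (Fin n) (Fin n) ℝ => M.map cc) h
            simp only [Matrix.map_mul] at this
            rw [map_lmat] at this
            simpa using this)
          ext i j
          have := congrFun (congrFun hz i) j
          simpa [cc] using this)
        (by
          intro t
          have := hJ z 1 t
          rwa [hlr, one_smul] at this)
      refine ⟨⟨K.map cc, ?_⟩, ?_⟩
      · rw [mem_skewM, ← Matrix.transpose_map, hK]; ext i j; simp
      · rw [hcomm, hcomm]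
        have := congrArg (fun M : Matrix (Fin n) (Fin n) ℝ => M.map cc) hKN
        have e1 : ∀ X Y : Matrix (Fin n) (Fin n) ℝ, (X + Y).map cc = X.map cc + Y.map cc := by
          intro X Y; ext i j; simp
        have e2 : ∀ X Y : Matrix (Fin n) (Fin n) ℝ, (X - Y).map cc = X.map cc - Y.map cc := by
          intro X Y; ext i j; simp
        have e3 : ∀ X : Matrix (Fin n) (Fin n) ℝ, (z • X).map cc = (z : ℂ) • X.map cc := by
          intro X; ext i j; simp [cc]
        simp only [e2, Matrix.map_mul, e1, e3] at this
        rw [add_comm ((symM v.2).map cc), ← this]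
        simp only [SC, DC, mul_add, add_mul, mul_smul_comm, smul_mul_assoc, smul_sub]
        abel)
  rw [hcomm] at h0 h1
  have hK0 : K.1 = 0 := by
    refine hoff K.1 K.2 ?_
    intro i j hij
    rw [h1]; simp [hij]
  rw [hK0] at h0 h1
  ext i
  · have := congrFun (congrFun h1 i) i
    simp [cc] at this
    simpa using this.symm
  · induction i using Sym2.ind with
    | _ i j =>
    have := congrFun (congrFun h0 i) j
    simp [cc, symM] at this
    simpa using this.symm

/-! ### Hyperbolic and strictly hyperbolic forms -/

/-- The univariate polynomial in `t`. -/
def upoly {n : ℕ} (c : LCoef n) (x y : ℝ) : Polynomial ℝ :=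
  hev c (Polynomial.C x) (Polynomial.C y) Polynomial.X

lemma aeval_upoly {n : ℕ} {A : Type*} [CommRing A] [Algebra ℝ A] (c : LCoef n) (x y : ℝ) (t : A) :
    Polynomial.aeval t (upoly c x y) = hev c (algebraMap ℝ A x) (algebraMap ℝ A y) t := by
  rw [upoly, hev_map]; simp

lemma eval_upoly {n : ℕ} (c : LCoef n) (x y t : ℝ) : (upoly c x y).eval t = hev c x y t := by
  rw [← Polynomial.coe_aeval_eq_eval, aeval_upoly]; rfl

lemma aevalC_upoly {n : ℕ} (c : LCoef n) (x y : ℝ) (t : ℂ) :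
    Polynomial.aeval t (upoly c x y) = hev c (x : ℂ) (y : ℂ) t := aeval_upoly c x y t

lemma upoly_monic {n : ℕ} (c : LCoef n) (x y : ℝ) :
    (upoly c x y).Monic ∧ (upoly c x y).natDegree = n := by
  have hdeg : (∑ p : LIdx n, algebraMap ℝ (Polynomial ℝ) (c p) * ((Polynomial.C x) ^ (p.2 : ℕ) *
    (Polynomial.C y) ^ (n - (p.1 : ℕ) - (p.2 : ℕ)) * Polynomial.X ^ (p.1 : ℕ)) : Polynomial ℝ).degree < (n : WithBot ℕ) := by
    rw [← Polynomial.mem_degreeLT]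
    refine Submodule.sum_mem _ fun p _ => ?_
    rw [Polynomial.mem_degreeLT, Polynomial.algebraMap_eq, ← Polynomial.C_pow, ← Polynomial.C_pow,
      ← Polynomial.C_mul, ← mul_assoc, ← Polynomial.C_mul]
    refine (Polynomial.degree_C_mul_X_pow_le _ _).trans_lt ?_
    exact_mod_cast p.1.2
  refine ⟨Polynomial.monic_X_pow_add hdeg, ?_⟩
  apply Polynomial.natDegree_eq_of_degree_eq_some
  rw [upoly, hev, Polynomial.degree_add_eq_left_of_degree_lt] <;> rw [Polynomial.degree_X_pow]
  exact hdeg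

lemma hev_ofReal {n : ℕ} (c : LCoef n) (x y t : ℝ) :
    hev c (x : ℂ) (y : ℂ) (t : ℂ) = ((hev c x y t : ℝ) : ℂ) := by
  have := hev_map (Algebra.ofId ℝ ℂ) c x y t
  exact this.symm

lemma hev_conj {n : ℕ} (c : LCoef n) (x y : ℝ) (t : ℂ) :
    hev c (x : ℂ) (y : ℂ) (starRingEnd ℂ t) = starRingEnd ℂ (hev c (x : ℂ) (y : ℂ) t) := by
  have := hev_map (Complex.conjAe : ℂ →ₐ[ℝ] ℂ) c (x : ℂ) (y : ℂ) t
  simpa using this.symm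

/-- Divided difference in `t`. -/
def ddv {n : ℕ} {A : Type*} [CommRing A] [Algebra ℝ A] (c : LCoef n) (x y t s : A) : A :=
  (∑ i ∈ Finset.range n, t ^ i * s ^ (n - 1 - i)) +
    ∑ p : LIdx n, algebraMap ℝ A (c p) * (x ^ (p.2 : ℕ) * y ^ (n - (p.1 : ℕ) - (p.2 : ℕ)) *
      ∑ i ∈ Finset.range (p.1 : ℕ), t ^ i * s ^ ((p.1 : ℕ) - 1 - i))

lemma ddv_mul {n : ℕ} {A : Type*} [CommRing A] [Algebra ℝ A] (c : LCoef n) (x y t s : A) :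
    ddv c x y t s * (t - s) = hev c x y t - hev c x y s := by
  simp only [ddv, hev, add_mul, Finset.sum_mul (Finset.univ), mul_assoc, geom_sum₂_mul]
  simp only [mul_sub, Finset.sum_sub_distrib]
  ring

lemma ddv_self {n : ℕ} (c : LCoef n) (x y t : ℝ) :
    ddv c (x : ℂ) (y : ℂ) (t : ℂ) (t : ℂ) = (((upoly c x y).derivative.eval t : ℝ) : ℂ) := by
  have key : ∀ (m : ℕ), (∑ i ∈ Finset.range m, (t : ℂ) ^ i * (t : ℂ) ^ (m - 1 - i)) =
      ((m * t ^ (m - 1) : ℝ) : ℂ) := by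
    intro m
    rw [Finset.sum_congr rfl (g := fun _ => (t : ℂ) ^ (m - 1))]
    · simp
    · intro i hi
      rw [← pow_add]
      congr 1
      have := Finset.mem_range.1 hi
      omega
  simp only [ddv, key, upoly, hev]
  rw [Polynomial.derivative_add, Polynomial.derivative_sum, Polynomial.eval_add,
    Polynomial.eval_finsetSum, Polynomial.derivative_X_pow]
  push_cast
  congr 1
  · simp
  · refine Finset.sum_congr rfl fun p _ => ?_
    rw [Polynomial.algebraMap_eq, ← Polynomial.C_pow, ← Polynomial.C_pow,
      ← Polynomial.C_mul, ← mul_assoc (Polynomial.C (c p)), ← Polynomial.C_mul,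
      Polynomial.derivative_C_mul_X_pow]
    simp
    ring

/-- Hyperbolicity. -/
def HypC {n : ℕ} (c : LCoef n) : Prop :=
  ∀ x y : ℝ, ∀ t : ℂ, hev c (x : ℂ) (y : ℂ) t = 0 → t.im = 0

/-- Strict hyperbolicity. -/
def StrC {n : ℕ} (c : LCoef n) : Prop :=
  ∀ x y : ℝ, x ^ 2 + y ^ 2 = 1 → ∀ t : ℂ, hev c (x : ℂ) (y : ℂ) t = 0 →
    ddv c (x : ℂ) (y : ℂ) t (starRingEnd ℂ t) ≠ 0

lemma StrC.intro {n : ℕ} {c : LCoef n}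
    (h1 : ∀ x y : ℝ, x ^ 2 + y ^ 2 = 1 → ∀ t : ℂ, hev c (x : ℂ) (y : ℂ) t = 0 → t.im = 0)
    (h2 : ∀ x y : ℝ, x ^ 2 + y ^ 2 = 1 → ∀ t : ℝ, hev c x y t = 0 →
      (upoly c x y).derivative.eval t ≠ 0) : StrC c := by
  intro x y hxy t ht
  obtain ⟨r, rfl⟩ : ∃ r : ℝ, t = r := ⟨t.re, by
    apply Complex.ext <;> simp [h1 x y hxy t ht]⟩
  rw [Complex.conj_ofReal, ddv_self]
  rw [hev_ofReal] at ht
  exact_mod_cast h2 x y hxy r (by exact_mod_cast ht)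

/-- Bound for the roots. -/
def rbd {n : ℕ} (c : LCoef n) : ℝ := 1 + ∑ p, |c p|

lemma root_bound {n : ℕ} {c : LCoef n} {x y : ℝ} (hx : |x| ≤ 1) (hy : |y| ≤ 1) {t : ℂ}
    (ht : hev c (x : ℂ) (y : ℂ) t = 0) : ‖t‖ ≤ rbd c := by
  have hs : 0 ≤ ∑ p, |c p| := Finset.sum_nonneg fun p _ => abs_nonneg _
  unfold rbd
  by_contra hcon
  push Not at hcon
  have h1 : 1 ≤ ‖t‖ := by linarith
  unfold hev at ht
  have h2 : ‖t‖ ^ n ≤ (∑ p, |c p|) * ‖t‖ ^ (n - 1) := by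
    rw [add_eq_zero_iff_eq_neg] at ht
    rw [← norm_pow, ht, norm_neg, Finset.sum_mul]
    refine (norm_sum_le _ _).trans (Finset.sum_le_sum fun p _ => ?_)
    simp only [norm_mul, norm_pow, Complex.coe_algebraMap, Complex.norm_real, Real.norm_eq_abs]
    refine mul_le_mul_of_nonneg_left ?_ (abs_nonneg _)
    have ha : |x| ^ (p.2 : ℕ) * |y| ^ (n - (p.1 : ℕ) - (p.2 : ℕ)) ≤ 1 :=
      mul_le_one₀ (pow_le_one₀ (abs_nonneg _) hx) (by positivity) (pow_le_one₀ (abs_nonneg _) hy)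
    have hb : ‖t‖ ^ (p.1 : ℕ) ≤ ‖t‖ ^ (n - 1) := by
      apply pow_le_pow_right₀ h1
      have := p.1.2
      omega
    calc _ ≤ 1 * ‖t‖ ^ (n - 1) := mul_le_mul ha hb (by positivity) zero_le_one
      _ = _ := one_mul _
  rcases Nat.eq_zero_or_pos n with h0 | h0
  · subst h0
    simp at ht
  · have h3 : ‖t‖ ^ n = ‖t‖ * ‖t‖ ^ (n - 1) := by
      rw [← pow_succ']; congr 1; omega
    rw [h3] at h2
    have h4 : 0 < ‖t‖ ^ (n - 1) := by positivity
    have := le_of_mul_le_mul_right h2 h4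
    linarith

lemma continuous_rbd (n : ℕ) : Continuous (rbd : LCoef n → ℝ) := by
  unfold rbd; fun_prop

lemma isOpen_StrC (n : ℕ) : IsOpen {c : LCoef n | StrC c} := by
  rw [isOpen_iff_mem_nhds]
  intro c0 hc0
  let K : Set ((ℝ × ℝ) × ℂ) :=
    (Metric.closedBall 0 1 ∩ {q | q.1 ^ 2 + q.2 ^ 2 = 1}) ×ˢ Metric.closedBall 0 (rbd c0 + 1)
  have hK : IsCompact K := by
    apply IsCompact.prod
    · apply (isCompact_closedBall _ _).inter_right
      apply isClosed_eq <;> fun_prop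
    · exact isCompact_closedBall _ _
  have hh : Continuous fun w : LCoef n × ((ℝ × ℝ) × ℂ) => hev w.1 (w.2.1.1 : ℂ) (w.2.1.2 : ℂ) w.2.2 := by
    unfold hev; simp only [Complex.coe_algebraMap]; fun_prop
  have hd : Continuous fun w : LCoef n × ((ℝ × ℝ) × ℂ) =>
      ddv w.1 (w.2.1.1 : ℂ) (w.2.1.2 : ℂ) w.2.2 (starRingEnd ℂ w.2.2) := by
    unfold ddv; simp only [Complex.coe_algebraMap]; fun_prop
  have h1 : ∀ᶠ c in nhds c0, ∀ w ∈ K, ¬ (hev c (w.1.1 : ℂ) (w.1.2 : ℂ) w.2 = 0 ∧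
      ddv c (w.1.1 : ℂ) (w.1.2 : ℂ) w.2 (starRingEnd ℂ w.2) = 0) := by
    apply hK.eventually_forall_of_forall_eventually
    intro w hw
    have hcl : IsClosed {w : LCoef n × ((ℝ × ℝ) × ℂ) | hev w.1 (w.2.1.1 : ℂ) (w.2.1.2 : ℂ) w.2.2 = 0 ∧
        ddv w.1 (w.2.1.1 : ℂ) (w.2.1.2 : ℂ) w.2.2 (starRingEnd ℂ w.2.2) = 0} :=
      (isClosed_eq hh continuous_const).inter (isClosed_eq hd continuous_const)
    refine hcl.isOpen_compl.mem_nhds ?_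
    rintro ⟨ha, hb⟩
    exact hc0 w.1.1 w.1.2 hw.1.2 w.2 ha hb
  have h2 : ∀ᶠ c in nhds c0, rbd c < rbd c0 + 1 :=
    (continuous_rbd n).continuousAt.eventually_lt_const (by linarith)
  filter_upwards [h1, h2] with c hc1 hc2
  intro x y hxy t ht hdt
  have hx : |x| ≤ 1 := by rw [← sq_le_one_iff_abs_le_one]; nlinarith [sq_nonneg y]
  have hy : |y| ≤ 1 := by rw [← sq_le_one_iff_abs_le_one]; nlinarith [sq_nonneg x]
  refine hc1 ((x, y), t) ⟨⟨?_, hxy⟩, ?_⟩ ⟨ht, hdt⟩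
  · rw [mem_closedBall_zero_iff, Prod.norm_def]
    simp [hx, hy]
  · rw [mem_closedBall_zero_iff]
    exact (root_bound hx hy ht).trans hc2.le

/-! ### The range of `Phi` -/

open scoped ComplexOrder in
lemma herm_root {n : ℕ} {M : Matrix (Fin n) (Fin n) ℂ} (hMh : M.IsHermitian) {t : ℂ}
    (ht : (M + t • (1 : Matrix (Fin n) (Fin n) ℂ)).det = 0) : t.im = 0 := by
  rw [← Matrix.exists_mulVec_eq_zero_iff] at ht
  obtain ⟨v, hv0, hv⟩ := ht
  rw [Matrix.add_mulVec, Matrix.smul_mulVec, Matrix.one_mulVec] at hv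
  have h1 : star v ⬝ᵥ (M *ᵥ v) = - t * (star v ⬝ᵥ v) := by
    rw [eq_neg_of_add_eq_zero_left hv]; simp
  have h2 : star (star v ⬝ᵥ (M *ᵥ v)) = star v ⬝ᵥ (M *ᵥ v) := by
    rw [← Matrix.star_dotProduct_star, star_star, Matrix.star_mulVec, hMh.eq,
      ← Matrix.dotProduct_mulVec]
  have h3 : (star v ⬝ᵥ v) ≠ 0 := by
    intro h; exact hv0 (dotProduct_star_self_eq_zero.1 h)
  have h4 : star (star v ⬝ᵥ v) = star v ⬝ᵥ v := by
    rw [← Matrix.star_dotProduct_star, star_star]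
  rw [h1, star_mul', h4] at h2
  have h5 := mul_right_cancel₀ h3 h2
  have := congrArg Complex.im h5
  simp at this
  linarith

lemma hyp_Phi {n : ℕ} (e : ESp n) : HypC (Phi e) := by
  intro x y t ht
  rw [hev_Phi] at ht
  set M : Matrix (Fin n) (Fin n) ℂ := (x • Matrix.diagonal e.1 + y • symM e.2).map (algebraMap ℝ ℂ)
    with hM
  have hl : lmat e (x : ℂ) (y : ℂ) t = M + t • 1 := by
    ext i j
    rw [lmat_apply, Matrix.add_apply, hM]
    by_cases h : i = j
    · subst h; simp
    · simp [h]
  have hMh : M.IsHermitian := by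
    ext i j
    have : symM e.2 i j = symM e.2 j i := congrFun (congrFun (symM_transpose e.2) j) i
    by_cases h : i = j
    · subst h; simp [hM]
    · simp [hM, h, Ne.symm h, this]
  rw [hl] at ht
  exact herm_root hMh ht

lemma Phi_bound {n : ℕ} (e : ESp n) : ‖e‖ ≤ (n + 1) * rbd (Phi e) := by
  have hr : 0 ≤ rbd (Phi e) := by
    have : 0 ≤ ∑ p, |Phi e p| := Finset.sum_nonneg fun p _ => abs_nonneg _
    unfold rbd; linarith
  have hroot : ∀ x y t : ℝ, |x| ≤ 1 → |y| ≤ 1 → (lmat e x y t).det = 0 → |t| ≤ rbd (Phi e) := by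
    intro x y t hx hy h
    have h1 : hev (Phi e) (x : ℂ) (y : ℂ) (t : ℂ) = 0 := by
      rw [hev_ofReal, hev_Phi, h]; simp
    simpa using root_bound hx hy h1
  have hD : ∀ i, |e.1 i| ≤ rbd (Phi e) := by
    intro i
    rw [← abs_neg]
    apply hroot 1 0 (-e.1 i) (by simp) (by simp)
    have : lmat e 1 0 (-e.1 i) = Matrix.diagonal fun j => e.1 j - e.1 i := by
      rw [lmat_real]
      ext a b
      by_cases h : a = b
      · subst h; simp [sub_eq_add_neg]
      · simp [h]
    rw [this, Matrix.det_diagonal]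
    exact Finset.prod_eq_zero (Finset.mem_univ i) (by simp)
  have hS : ∀ i j, |symM e.2 i j| ≤ n * rbd (Phi e) := by
    obtain ⟨O, μ, h1, h2, h3⟩ := spectral_real (symM_transpose e.2)
    have hμ : ∀ i, |μ i| ≤ rbd (Phi e) := by
      intro i
      rw [← abs_neg]
      apply hroot 0 1 (-μ i) (by simp) (by simp)
      have : lmat e 0 1 (-μ i) = O * Matrix.diagonal (fun j => μ j - μ i) * Oᵀ := by
        have hd : Matrix.diagonal (fun j => μ j - μ i) =
            Matrix.diagonal μ + (-μ i) • (1 : Matrix (Fin n) (Fin n) ℝ) := by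
          ext a b
          by_cases h : a = b
          · subst h; simp [sub_eq_add_neg]
          · simp [h]
        rw [lmat_real, hd, mul_add, add_mul, ← h3]
        simp [h2]
      rw [this, Matrix.det_mul, Matrix.det_mul, Matrix.det_diagonal,
        Finset.prod_eq_zero (Finset.mem_univ i) (by simp)]
      simp
    have hO : ∀ i k, |O i k| ≤ 1 := by
      intro i k
      rw [← sq_le_one_iff_abs_le_one]
      have := congrFun (congrFun h2 i) i
      simp only [Matrix.mul_apply, Matrix.transpose_apply, Matrix.one_apply_eq] at this
      rw [← this, sq]
      exact Finset.single_le_sum (f := fun k => O i k * O i k) (fun k _ => mul_self_nonneg _) (Finset.mem_univ k)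
    intro i j
    rw [h3, Matrix.mul_apply]
    refine (Finset.abs_sum_le_sum_abs _ _).trans ?_
    refine (Finset.sum_le_card_nsmul _ _ (rbd (Phi e)) ?_).trans ?_
    · intro k _
      rw [Matrix.mul_diagonal, Matrix.transpose_apply, abs_mul, abs_mul]
      calc |O i k| * |μ k| * |O j k| ≤ 1 * rbd (Phi e) * 1 := by
            gcongr
            · exact hO i k
            · exact hμ k
            · exact hO j k
        _ = _ := by ring
    · simp
  rw [Prod.norm_def]
  apply max_le
  · rw [pi_norm_le_iff_of_nonneg (by positivity)]
    intro i
    refine (hD i).trans ?_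
    nlinarith [hr, (Nat.cast_nonneg n : (0 : ℝ) ≤ n)]
  · rw [pi_norm_le_iff_of_nonneg (by positivity)]
    intro s
    induction s using Sym2.ind with
    | _ i j =>
    refine (hS i j).trans ?_
    nlinarith [hr, (Nat.cast_nonneg n : (0 : ℝ) ≤ n)]

lemma isClosed_range_Phi (n : ℕ) : IsClosed (Set.range (Phi : ESp n → LCoef n)) := by
  rw [← closure_subset_iff_isClosed]
  intro c0 hc0
  let K : Set (ESp n) := Metric.closedBall 0 ((n + 1) * (rbd c0 + 1))
  have hK : IsClosed (Phi '' K) :=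
    ((isCompact_closedBall _ _).image (contDiff_Phi n).continuous).isClosed
  have h1 : c0 ∈ closure (Phi '' K) := by
    rw [mem_closure_iff_nhds] at hc0 ⊢
    intro t ht
    have h2 : ∀ᶠ c in nhds c0, rbd c < rbd c0 + 1 :=
      (continuous_rbd n).continuousAt.eventually_lt_const (by linarith)
    obtain ⟨c, ⟨hct, hcr⟩, e, rfl⟩ := hc0 _ (Filter.inter_mem ht h2)
    refine ⟨Phi e, hct, e, ?_, rfl⟩
    rw [mem_closedBall_zero_iff]
    refine (Phi_bound e).trans ?_
    have : rbd (Phi e) < rbd c0 + 1 := hcr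
    gcongr
  rw [hK.closure_eq] at h1
  obtain ⟨e, -, he⟩ := h1
  exact ⟨e, he⟩

/-! ### Strictly hyperbolic determinants -/

lemma hev_Phi_deriv {n : ℕ} (e : ESp n) (x y t : ℝ) :
    (upoly (Phi e) x y).derivative.eval t =
      ∑ l, ((lmat e x y t).updateRow l ((1 : Matrix (Fin n) (Fin n) ℝ) l)).det := by
  have : upoly (Phi e) x y = dpoly (lmat e x y 0) 1 := by
    apply Polynomial.funext
    intro r
    rw [eval_upoly, eval_dpoly, hev_Phi]
    congr 1
    simp [lmat]
  rw [this, eval_derivative_dpoly]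
  have : lmat e x y 0 + t • 1 = lmat e x y t := by simp [lmat]
  rw [this]

lemma StrC.skew {n : ℕ} {e : ESp n} (he : StrC (Phi e)) {x y : ℝ} (hxy : x ^ 2 + y ^ 2 = 1)
    (t : ℂ) {B : Matrix (Fin n) (Fin n) ℂ} (hB : Bᵀ = -B)
    (hBM : B * lmat e (x : ℂ) (y : ℂ) t = 0) : B = 0 := by
  by_contra hB0
  have h0 := det_updateRow_of_skew hB hB0 (skew_diag hB) hBM
  have hn : (lmat e (x : ℂ) (y : ℂ) t).det = 0 := by
    rcases Nat.eq_zero_or_pos n with hn | hn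
    · subst hn
      exact absurd (Subsingleton.elim _ _) hB0
    · have := h0 ⟨0, hn⟩ (lmat e (x : ℂ) (y : ℂ) t ⟨0, hn⟩)
      rwa [Matrix.updateRow_eq_self] at this
  have ht : hev (Phi e) (x : ℂ) (y : ℂ) t = 0 := by rw [hev_Phi, hn]
  obtain ⟨r, rfl⟩ : ∃ r : ℝ, t = r := ⟨t.re, by
    apply Complex.ext <;> simp [hyp_Phi e x y t ht]⟩
  refine he x y hxy r ht ?_
  rw [Complex.conj_ofReal, ddv_self, hev_Phi_deriv]
  have : ∀ l, ((lmat e x y r).updateRow l ((1 : Matrix (Fin n) (Fin n) ℝ) l)).det = 0 := by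
    intro l
    have h1 := h0 l ((1 : Matrix (Fin n) (Fin n) ℂ) l)
    have h2 : algebraMap ℝ ℂ ((lmat e x y r).updateRow l ((1 : Matrix (Fin n) (Fin n) ℝ) l)).det = 0 := by
      rw [RingHom.map_det, ← h1]
      congr 1
      rw [RingHom.mapMatrix_apply, Matrix.map_updateRow, map_lmat]
      congr 1
      ext j
      by_cases h : l = j
      · subst h; simp
      · simp [h]
    simpa using h2
  simp [this]

lemma StrC.injective {n : ℕ} {e : ESp n} (he : StrC (Phi e)) : Function.Injective e.1 := by
  intro i j hij
  by_contra hne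
  let Q : Matrix (Fin n) (Fin n) ℂ := Matrix.single i j 1 - Matrix.single j i 1
  have hQ : Q = 0 := he.skew (x := 1) (y := 0) (by norm_num) (-(e.1 i : ℂ)) (by simp [Q]) (by
    have : lmat e ((1 : ℝ) : ℂ) ((0 : ℝ) : ℂ) (-(e.1 i : ℂ)) = Matrix.diagonal fun k => ((e.1 k : ℂ) - e.1 i) := by
      ext a b
      rw [lmat_apply]
      by_cases h : a = b
      · subst h; simp [sub_eq_add_neg]
      · simp [h]
    rw [this]
    ext a b
    simp only [Matrix.mul_diagonal, Q, Matrix.sub_apply, Matrix.zero_apply, Matrix.single_apply]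
    by_cases h1 : j = b
    · subst h1; simp [hij]
    · by_cases h2 : i = b
      · subst h2; simp
      · simp [h1, h2])
  have := congrFun (congrFun hQ i) j
  simp [Q, hne, Ne.symm hne] at this

lemma StrC.skew_one {n : ℕ} {e : ESp n} (he : StrC (Phi e)) (z : ℝ)
    (t : ℂ) {B : Matrix (Fin n) (Fin n) ℂ} (hB : Bᵀ = -B)
    (hBM : B * lmat e (z : ℂ) 1 t = 0) : B = 0 := by
  set r := Real.sqrt (z ^ 2 + 1) with hr
  have hr0 : 0 < r := Real.sqrt_pos.2 (by positivity)
  have hr2 : r ^ 2 = z ^ 2 + 1 := Real.sq_sqrt (by positivity)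
  apply he.skew (x := z / r) (y := 1 / r) (by field_simp; linarith) (t / r) hB
  have : lmat e ((z / r : ℝ) : ℂ) ((1 / r : ℝ) : ℂ) (t / r) = ((1 / r : ℝ) : ℂ) • lmat e (z : ℂ) 1 t := by
    simp only [lmat, smul_add, smul_smul]
    congr 2
    · congr 1; push_cast; ring
    · congr 1; push_cast; ring
    · push_cast; ring
  rw [this, Matrix.mul_smul, hBM, smul_zero]

/-! ### Nuij smoothing: univariate part -/

/-- All complex roots are real. -/
def RRoot (p : Polynomial ℝ) : Prop := ∀ t : ℂ, Polynomial.aeval t p = 0 → t.im = 0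

lemma RRoot.splits {p : Polynomial ℝ} (h : RRoot p) : p.Splits := by
  apply Polynomial.Splits.of_splits_map (algebraMap ℝ ℂ) (IsAlgClosed.splits _)
  intro a ha
  have : Polynomial.aeval a p = 0 := by
    rw [Polynomial.aeval_def, Polynomial.eval₂_eq_eval_map]
    exact Polynomial.isRoot_of_mem_roots ha
  exact ⟨a.re, by apply Complex.ext <;> simp [h a this]⟩

lemma im_sum_inv {t : ℂ} (ht : t.im ≠ 0) (m : Multiset ℂ) (hm : ∀ z ∈ m, z.im = 0) :
    t.im * ((m.map fun z => 1 / (t - z)).sum).im ≤ 0 ∧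
      (m ≠ 0 → t.im * ((m.map fun z => 1 / (t - z)).sum).im < 0) := by
  induction m using Multiset.induction_on with
  | empty => simp
  | cons a m ih =>
    have ih := (ih fun z hz => hm z (Multiset.mem_cons_of_mem hz)).1
    have ha : a.im = 0 := hm a (Multiset.mem_cons_self a m)
    have h1 : t.im * (1 / (t - a)).im < 0 := by
      have hne : t - a ≠ 0 := by
        intro h
        have := congrArg Complex.im h
        simp [ha] at this
        exact ht this
      have : (1 / (t - a)).im = - t.im / Complex.normSq (t - a) := by
        rw [one_div, Complex.inv_im, Complex.sub_im, ha, sub_zero]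
      rw [this, mul_div_assoc']
      apply div_neg_of_neg_of_pos
      · have := sq_pos_of_ne_zero ht
        nlinarith
      · exact Complex.normSq_pos.2 hne
    rw [Multiset.map_cons, Multiset.sum_cons, Complex.add_im, mul_add]
    exact ⟨by linarith, fun _ => by linarith⟩

lemma RRoot.op {p : Polynomial ℝ} (hm : p.Monic) (h : RRoot p) (a : ℝ) :
    RRoot (p + Polynomial.C a * Polynomial.derivative p) := by
  intro t ht
  by_contra him
  have hp : Polynomial.aeval t p ≠ 0 := fun h0 => him (h t h0)
  set q := p.map (algebraMap ℝ ℂ) with hq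
  have e1 : Polynomial.aeval t p = q.eval t := by
    rw [Polynomial.aeval_def, Polynomial.eval₂_eq_eval_map]
  have e2 : Polynomial.aeval t (Polynomial.derivative p) = (Polynomial.derivative q).eval t := by
    rw [Polynomial.aeval_def, Polynomial.eval₂_eq_eval_map, hq, Polynomial.derivative_map]
  rw [map_add, map_mul, Polynomial.aeval_C, e1, e2] at ht
  rw [e1] at hp
  have hd := (IsAlgClosed.splits q).eval_derivative_div_eval_of_ne_zero hp
  by_cases ha : a = 0
  · subst ha
    simp at ht
    exact hp ht
  have ha' : (a : ℂ) ≠ 0 := by exact_mod_cast ha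
  have h2 : (Polynomial.derivative q).eval t / q.eval t = ((-(1 / a) : ℝ) : ℂ) := by
    rw [div_eq_iff hp]
    push_cast
    field_simp
    simp at ht
    linear_combination ht
  rw [h2] at hd
  have hr := im_sum_inv him q.roots (by
    intro z hz
    apply h z
    rw [Polynomial.aeval_def, Polynomial.eval₂_eq_eval_map]
    exact Polynomial.isRoot_of_mem_roots hz)
  rw [← hd, Complex.ofReal_im, mul_zero] at hr
  have h0 : q.roots = 0 := by
    by_contra h0
    exact lt_irrefl _ (hr.2 h0)
  rw [h0] at hd
  simp at hd
  exact ha hd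

lemma turan_aux (m : Multiset ℝ) (r : ℝ) :
    let p : Polynomial ℝ := (m.map fun z => Polynomial.X - Polynomial.C z).prod
    p.eval r ≠ 0 → 0 ≤ (p.derivative.eval r) ^ 2 - p.eval r * p.derivative.derivative.eval r ∧
    (m ≠ 0 → 0 < (p.derivative.eval r) ^ 2 - p.eval r * p.derivative.derivative.eval r) := by
  induction m using Multiset.induction_on with
  | empty => simp
  | cons a m ih =>
    intro p hp
    set q : Polynomial ℝ := (m.map fun z => Polynomial.X - Polynomial.C z).prod with hq
    have hpq : p = (Polynomial.X - Polynomial.C a) * q := by simp [p, q]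
    rw [hpq, Polynomial.eval_mul] at hp
    have hq0 : q.eval r ≠ 0 := right_ne_zero_of_mul hp
    have ih := (ih hq0).1
    have key : (p.derivative.eval r) ^ 2 - p.eval r * p.derivative.derivative.eval r =
        (q.eval r) ^ 2 + (r - a) ^ 2 * ((q.derivative.eval r) ^ 2 - q.eval r * q.derivative.derivative.eval r) := by
      rw [hpq]
      simp
      ring
    have h1 : 0 < (q.eval r) ^ 2 := by positivity
    have h2 : 0 ≤ (r - a) ^ 2 * ((q.derivative.eval r) ^ 2 - q.eval r * q.derivative.derivative.eval r) :=
      mul_nonneg (sq_nonneg _) ih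
    rw [key]
    exact ⟨by linarith, fun _ => by linarith⟩

lemma RRoot.mult {p : Polynomial ℝ} (hm : p.Monic) (h : RRoot p) {a : ℝ} (ha : a ≠ 0)
    (hP : p + Polynomial.C a * Polynomial.derivative p ≠ 0) (r : ℝ) :
    (p + Polynomial.C a * Polynomial.derivative p).rootMultiplicity r ≤ max 1 (p.rootMultiplicity r - 1) := by
  by_cases hr : p.eval r = 0
  · have hk : 0 < p.rootMultiplicity r := (Polynomial.rootMultiplicity_pos hm.ne_zero).2 hr
    refine le_trans ?_ (le_max_right _ _)
    rw [Polynomial.rootMultiplicity_le_iff hP]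
    rw [Nat.sub_add_cancel hk]
    intro hdvd
    have h1 : (Polynomial.X - Polynomial.C r) ^ (p.rootMultiplicity r) ∣ p :=
      Polynomial.pow_rootMultiplicity_dvd p r
    have h2 : (Polynomial.X - Polynomial.C r) ^ (p.rootMultiplicity r) ∣
        Polynomial.C a * Polynomial.derivative p := (dvd_add_right h1).1 hdvd
    have h3 : (Polynomial.X - Polynomial.C r) ^ (p.rootMultiplicity r) ∣ Polynomial.derivative p :=
      ((Polynomial.isUnit_C.2 (isUnit_iff_ne_zero.2 ha)).dvd_mul_left).1 h2
    have hd0 : Polynomial.derivative p ≠ 0 := by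
      intro h0
      have h4 := Polynomial.derivative_eq_zero.1 h0
      have h4 := Polynomial.eq_one_of_monic_natDegree_zero hm h4
      rw [h4] at hr
      simp at hr
    have h5 := (Polynomial.le_rootMultiplicity_iff hd0).2 h3
    rw [Polynomial.derivative_rootMultiplicity_of_root hr] at h5
    omega
  · refine le_trans ?_ (le_max_left _ _)
    by_contra hcon
    push Not at hcon
    rw [Polynomial.one_lt_rootMultiplicity_iff_isRoot hP] at hcon
    obtain ⟨h1, h2⟩ := hcon
    simp only [Polynomial.IsRoot, Polynomial.derivative_add, Polynomial.derivative_C_mul,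
      Polynomial.eval_add, Polynomial.eval_mul, Polynomial.eval_C] at h1 h2
    have hpe := h.splits.eq_prod_roots_of_monic hm
    have ht := turan_aux p.roots r
    simp only at ht
    rw [← hpe] at ht
    obtain ⟨-, ht⟩ := ht hr
    have hroots : p.roots ≠ 0 := by
      intro h0
      rw [h0] at hpe
      simp at hpe
      rw [hpe] at h1
      simp at h1
    have ht := ht hroots
    have h3 : p.derivative.eval r = - p.eval r / a := by field_simp; linarith
    have h4 : p.derivative.derivative.eval r = p.eval r / a ^ 2 := by
      rw [h3] at h2
      field_simp at h2 ⊢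
      linarith
    rw [h3, h4] at ht
    apply lt_irrefl (0 : ℝ)
    calc (0 : ℝ) < _ := ht
      _ = 0 := by field_simp; ring

/-! ### Nuij smoothing: ternary forms -/

lemma monicHom_toMv {n : ℕ} (c : LCoef n) : MonicHom n (toMv c) := by
  apply monicHom_of_eval
  · unfold toMv hev
    apply MvPolynomial.IsHomogeneous.add
    · simpa using (MvPolynomial.isHomogeneous_X ℝ (2 : Fin 3)).pow n
    · apply MvPolynomial.IsHomogeneous.sum
      rintro ⟨j, k⟩ _
      have h1 := (((MvPolynomial.isHomogeneous_X ℝ (0 : Fin 3)).pow (k : ℕ)).mul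
        ((MvPolynomial.isHomogeneous_X ℝ (1 : Fin 3)).pow (n - (j : ℕ) - (k : ℕ)))).mul
        ((MvPolynomial.isHomogeneous_X ℝ (2 : Fin 3)).pow (j : ℕ))
      have h2 := (MvPolynomial.isHomogeneous_C (Fin 3) (c ⟨j, k⟩)).mul h1
      have hj := j.2
      have hk : (k : ℕ) < n - (j : ℕ) + 1 := k.2
      have h3 : 0 + (1 * (k : ℕ) + 1 * (n - (j : ℕ) - (k : ℕ)) + 1 * (j : ℕ)) = n := by omega
      rw [h3] at h2
      exact h2
  · have h := aeval_toMv c (0 : ℝ) 0 1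
    have h' : MvPolynomial.aeval ![(0 : ℝ), 0, 1] (toMv c) = MvPolynomial.eval ![0, 0, 1] (toMv c) := rfl
    rw [← h', h, hev]
    rw [Finset.sum_eq_zero]
    · simp
    · rintro ⟨j, k⟩ _
      have := j.2
      have := k.2
      rcases Nat.eq_zero_or_pos (k : ℕ) with h0 | h0
      · have : n - (j : ℕ) - (k : ℕ) ≠ 0 := by omega
        simp [this]
      · simp [h0.ne']

/-- The operator `P + s X_k ∂P/∂t`. -/
def opL {n : ℕ} (k : Fin 3) (s : ℝ) (c : LCoef n) : LCoef n :=
  coefs n (toMv c + MvPolynomial.C s * (MvPolynomial.X k * MvPolynomial.pderiv 2 (toMv c)))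

lemma monicHom_op {n : ℕ} (hn : 0 < n) {k : Fin 3} (hk : k ≠ 2) (s : ℝ) (c : LCoef n) :
    MonicHom n (toMv c + MvPolynomial.C s * (MvPolynomial.X k * MvPolynomial.pderiv 2 (toMv c))) := by
  have h0 := monicHom_toMv c
  apply monicHom_of_eval
  · refine h0.1.add ?_
    have h1 := (MvPolynomial.isHomogeneous_C (Fin 3) s).mul
      ((MvPolynomial.isHomogeneous_X ℝ k).mul (h0.1.pderiv (i := 2)))
    convert h1 using 1
    omega
  · have h := aeval_toMv c (0 : ℝ) 0 1
    have hev1 : MvPolynomial.eval ![0, 0, 1] (toMv c) = 1 := by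
      have h' : MvPolynomial.aeval ![(0 : ℝ), 0, 1] (toMv c) = MvPolynomial.eval ![0, 0, 1] (toMv c) := rfl
      rw [← h', h, ← eval_upoly, upoly]
      rw [hev, Polynomial.eval_add, Polynomial.eval_finsetSum, Finset.sum_eq_zero]
      · simp
      · rintro ⟨j, k⟩ _
        have := j.2
        have := k.2
        rcases Nat.eq_zero_or_pos (k : ℕ) with h0 | h0
        · have : n - (j : ℕ) - (k : ℕ) ≠ 0 := by omega
          simp [this]
        · simp [h0.ne']
    have hk0 : (![0, 0, 1] : Fin 3 → ℝ) k = 0 := by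
      fin_cases k
      · rfl
      · rfl
      · exact absurd rfl hk
    simp [hev1, hk0]

lemma derivative_aeval (x y : ℝ) (P : MvPolynomial (Fin 3) ℝ) :
    Polynomial.derivative (MvPolynomial.aeval ![Polynomial.C x, Polynomial.C y, Polynomial.X] P) =
      MvPolynomial.aeval ![Polynomial.C x, Polynomial.C y, Polynomial.X] (MvPolynomial.pderiv 2 P) := by
  induction P using MvPolynomial.induction_on with
  | C a => simp
  | add p q hp hq => simp [hp, hq]
  | mul_X p i hp =>
    rw [map_mul, Polynomial.derivative_mul, hp, MvPolynomial.pderiv_mul, map_add, map_mul, map_mul]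
    fin_cases i <;> simp

lemma upoly_op {n : ℕ} (hn : 0 < n) {k : Fin 3} (hk : k ≠ 2) (s : ℝ) (c : LCoef n) (x y : ℝ) :
    upoly (opL k s c) x y = upoly c x y +
      Polynomial.C (s * (![x, y, 0] : Fin 3 → ℝ) k) * Polynomial.derivative (upoly c x y) := by
  have e1 : ∀ c : LCoef n, upoly c x y =
      MvPolynomial.aeval ![Polynomial.C x, Polynomial.C y, Polynomial.X] (toMv c) := by
    intro c; rw [aeval_toMv]; rfl
  rw [e1, e1, opL, toMv_coefs (monicHom_op hn hk s c), derivative_aeval, map_add, map_mul, map_mul,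
    ← mul_assoc]
  congr 2
  fin_cases k
  · simp
  · simp
  · exact absurd rfl hk

lemma continuous_op (n : ℕ) (k : Fin 3) :
    Continuous fun w : ℝ × LCoef n => opL k w.1 w.2 := by
  have h0 : SmC fun w : ℝ × LCoef n => toMv w.2 := SmC.toMv contDiff_snd
  have h1 : SmC fun w : ℝ × LCoef n => MvPolynomial.pderiv 2 (toMv w.2) := by
    intro d
    simp only [MvPolynomial.coeff_pderiv]
    exact (h0 _).mul contDiff_const
  have h2 := SmC.coefs n (SmC.add h0 (SmC.mul (SmC.C (contDiff_fst (𝕜 := ℝ) (E := ℝ) (F := LCoef n)))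
    (SmC.mul (SmC.const (MvPolynomial.X k)) h1)))
  exact h2.continuous

lemma opL_zero {n : ℕ} (k : Fin 3) (c : LCoef n) : opL k 0 c = c := by
  simp [opL, coefs_toMv]

/-- Nuij operator. -/
def nuij {n : ℕ} (s : ℝ) (c : LCoef n) : LCoef n :=
  (opL 1 s)^[n] ((opL 0 s)^[n] c)

lemma continuous_iter {n : ℕ} (k : Fin 3) (m : ℕ) :
    Continuous fun w : ℝ × LCoef n => (opL k w.1)^[m] w.2 := by
  induction m with
  | zero => exact continuous_snd
  | succ m ih =>
    simp only [Function.iterate_succ_apply']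
    have h0 : Continuous fun w : ℝ × LCoef n => (w.1, (opL k w.1)^[m] w.2) :=
      continuous_fst.prodMk ih
    have h1 := (continuous_op n k).comp h0
    exact h1

lemma continuous_nuij (n : ℕ) : Continuous fun w : ℝ × LCoef n => nuij w.1 w.2 := by
  have h0 : Continuous fun w : ℝ × LCoef n => (w.1, (opL 0 w.1)^[n] w.2) :=
    continuous_fst.prodMk (continuous_iter 0 n)
  have h1 := (continuous_iter (n := n) 1 n).comp h0
  exact h1

lemma nuij_zero {n : ℕ} (c : LCoef n) : nuij 0 c = c := by
  have : ∀ k : Fin 3, (opL k 0 : LCoef n → LCoef n) = id := fun k => funext fun c => opL_zero k c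
  simp [nuij, this]

lemma iter_RRoot {n : ℕ} (hn : 0 < n) {k : Fin 3} (hk : k ≠ 2) (s : ℝ) (c : LCoef n) (x y : ℝ)
    (h : RRoot (upoly c x y)) (m : ℕ) : RRoot (upoly ((opL k s)^[m] c) x y) := by
  induction m with
  | zero => exact h
  | succ m ih =>
    rw [Function.iterate_succ_apply', upoly_op hn hk]
    exact ih.op (upoly_monic _ _ _).1 _

lemma iter_mult {n : ℕ} (hn : 0 < n) {k : Fin 3} (hk : k ≠ 2) (s : ℝ) (c : LCoef n) (x y : ℝ)
    (h : RRoot (upoly c x y)) (hs : s * (![x, y, 0] : Fin 3 → ℝ) k ≠ 0) (m : ℕ) (r : ℝ) :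
    (upoly ((opL k s)^[m] c) x y).rootMultiplicity r ≤ max 1 (n - m) := by
  induction m with
  | zero =>
    refine le_trans ?_ (le_max_right _ _)
    have := (upoly_monic c x y).2
    rw [Function.iterate_zero, id, Nat.sub_zero, ← Polynomial.count_roots]
    exact ((Multiset.count_le_card _ _).trans (Polynomial.card_roots' _)).trans this.le
  | succ m ih =>
    have h1 := iter_RRoot hn hk s c x y h m
    have h2 : (upoly (opL k s ((opL k s)^[m] c)) x y) ≠ 0 := (upoly_monic _ _ _).1.ne_zero
    rw [Function.iterate_succ_apply']
    rw [upoly_op hn hk] at h2 ⊢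
    refine (h1.mult (upoly_monic _ _ _).1 hs h2 r).trans ?_
    omega

lemma iter_mult_one {n : ℕ} (hn : 0 < n) {k : Fin 3} (hk : k ≠ 2) (s : ℝ) (c : LCoef n) (x y : ℝ)
    (h : RRoot (upoly c x y)) (hc : ∀ r, (upoly c x y).rootMultiplicity r ≤ 1) (m : ℕ) (r : ℝ) :
    (upoly ((opL k s)^[m] c) x y).rootMultiplicity r ≤ 1 := by
  induction m with
  | zero => exact hc r
  | succ m ih =>
    have h1 := iter_RRoot hn hk s c x y h m
    have h2 : (upoly (opL k s ((opL k s)^[m] c)) x y) ≠ 0 := (upoly_monic _ _ _).1.ne_zero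
    rw [Function.iterate_succ_apply']
    rw [upoly_op hn hk] at h2 ⊢
    by_cases hs : s * (![x, y, 0] : Fin 3 → ℝ) k = 0
    · rw [hs]; simpa using ih
    · refine (h1.mult (upoly_monic _ _ _).1 hs h2 r).trans ?_
      omega

lemma nuij_str {n : ℕ} (hn : 0 < n) {s : ℝ} (hs : s ≠ 0) {c : LCoef n} (hc : HypC c) :
    StrC (nuij s c) := by
  have h0 : ∀ x y, RRoot (upoly c x y) := by
    intro x y t ht
    rw [aevalC_upoly] at ht
    exact hc x y t ht
  have k0 : (0 : Fin 3) ≠ 2 := by decide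
  have k1 : (1 : Fin 3) ≠ 2 := by decide
  have h1 : ∀ x y, RRoot (upoly ((opL 0 s)^[n] c) x y) := fun x y => iter_RRoot hn k0 s c x y (h0 x y) n
  have h2 : ∀ x y, RRoot (upoly (nuij s c) x y) := fun x y => iter_RRoot hn k1 s _ x y (h1 x y) n
  apply StrC.intro
  · intro x y _ t ht
    apply h2 x y t
    rwa [aevalC_upoly]
  · intro x y hxy t ht hd
    have hm : (upoly (nuij s c) x y).rootMultiplicity t ≤ 1 := by
      by_cases hx : x = 0
      · have hy : y ≠ 0 := by
          rintro rfl
          subst hx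
          norm_num at hxy
        have := iter_mult hn k1 s ((opL 0 s)^[n] c) x y (h1 x y) (by simp [hs, hy]) n t
        simpa [nuij] using this
      · refine iter_mult_one hn k1 s ((opL 0 s)^[n] c) x y (h1 x y) ?_ n t
        intro r
        have := iter_mult hn k0 s c x y (h0 x y) (by simp [hs, hx]) n r
        simpa using this
    rw [← not_lt] at hm
    apply hm
    rw [Polynomial.one_lt_rootMultiplicity_iff_isRoot (upoly_monic _ _ _).1.ne_zero]
    exact ⟨by rw [Polynomial.IsRoot, eval_upoly, ht], hd⟩

/-! ### Scaling -/

/-- Scaling of `x` and `y`. -/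
def scL {n : ℕ} (l : ℝ) (c : LCoef n) : LCoef n := fun p => l ^ (n - (p.1 : ℕ)) * c p

lemma hev_scL {n : ℕ} (l : ℝ) (c : LCoef n) (x y : ℝ) (t : ℂ) :
    hev (scL l c) (x : ℂ) (y : ℂ) t = hev c ((l * x : ℝ) : ℂ) ((l * y : ℝ) : ℂ) t := by
  unfold hev scL
  congr 1
  refine Finset.sum_congr rfl fun p _ => ?_
  have h1 := p.2.2
  have h2 : n - (p.1 : ℕ) = (p.2 : ℕ) + (n - (p.1 : ℕ) - (p.2 : ℕ)) := by omega
  simp only [Complex.coe_algebraMap]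
  push_cast
  nth_rewrite 1 [h2]
  rw [pow_add, mul_pow, mul_pow]
  ring

lemma HypC.scL {n : ℕ} {c : LCoef n} (hc : HypC c) (l : ℝ) : HypC (scL l c) := by
  intro x y t ht
  rw [hev_scL] at ht
  exact hc _ _ t ht

lemma scL_zero {n : ℕ} (c : LCoef n) : scL 0 c = 0 := by
  ext p
  have := p.1.2
  simp [scL]
  left; omega

lemma scL_one {n : ℕ} (c : LCoef n) : scL 1 c = c := by
  ext p; simp [scL]

lemma continuous_scL {n : ℕ} (c : LCoef n) : Continuous fun l : ℝ => scL l c := by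
  unfold scL; fun_prop

/-! ### The bad set -/

/-- Derivative in `x` at `y = 1`. -/
def hdx {n : ℕ} (c : LCoef n) (z t : ℂ) : ℂ :=
  ∑ p : LIdx n, (c p : ℂ) * (((p.2 : ℕ) : ℂ) * z ^ ((p.2 : ℕ) - 1) * t ^ (p.1 : ℕ))

/-- Derivative in `t` at `y = 1`. -/
def hdt {n : ℕ} (c : LCoef n) (z t : ℂ) : ℂ :=
  (n : ℂ) * t ^ (n - 1) +
    ∑ p : LIdx n, (c p : ℂ) * (z ^ (p.2 : ℕ) * (((p.1 : ℕ) : ℂ) * t ^ ((p.1 : ℕ) - 1)))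

/-- Forms having a nonreal singular point. -/
def BadC {n : ℕ} (c : LCoef n) : Prop :=
  ∃ z t : ℂ, 0 < z.im ∧ hev c z 1 t = 0 ∧ hdx c z t = 0 ∧ hdt c z t = 0

lemma hdx_eq {n : ℕ} (c : LCoef n) (z t : ℂ) :
    (Polynomial.derivative (hev c (Polynomial.X : Polynomial ℂ) 1 (Polynomial.C t))).eval z =
      hdx c z t := by
  simp only [hev, hdx, ← Polynomial.C_pow, one_pow, mul_one, Polynomial.derivative_add,
    Polynomial.derivative_C, zero_add, Polynomial.derivative_sum, Polynomial.eval_finsetSum]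
  refine Finset.sum_congr rfl fun p _ => ?_
  have : algebraMap ℝ (Polynomial ℂ) (c p) = Polynomial.C (c p : ℂ) := rfl
  rw [this, Polynomial.derivative_C_mul, Polynomial.derivative_mul, Polynomial.derivative_C,
    Polynomial.derivative_X_pow]
  simp

lemma hdt_eq {n : ℕ} (c : LCoef n) (z t : ℂ) :
    (Polynomial.derivative (hev c (Polynomial.C z) 1 (Polynomial.X : Polynomial ℂ))).eval t =
      hdt c z t := by
  simp only [hev, hdt, ← Polynomial.C_pow, one_pow, mul_one, Polynomial.derivative_add,
    Polynomial.derivative_sum, Polynomial.eval_finsetSum, Polynomial.eval_add,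
    Polynomial.derivative_X_pow]
  congr 1
  · simp
  refine Finset.sum_congr rfl fun p _ => ?_
  have : algebraMap ℝ (Polynomial ℂ) (c p) = Polynomial.C (c p : ℂ) := rfl
  rw [this, Polynomial.derivative_C_mul, Polynomial.derivative_mul, Polynomial.derivative_C,
    Polynomial.derivative_X_pow]
  simp

lemma eval_lmat {n : ℕ} (e : ESp n) (p q : Polynomial ℂ) (r : ℂ) :
    (lmat e p 1 q).map (Polynomial.eval r) = lmat e (p.eval r) 1 (q.eval r) := by
  ext i j
  rw [Matrix.map_apply, lmat_apply, lmat_apply]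
  have : ∀ a : ℝ, algebraMap ℝ (Polynomial ℂ) a = Polynomial.C (a : ℂ) := fun _ => rfl
  simp only [this, Polynomial.eval_add, Polynomial.eval_mul, Polynomial.eval_C, Polynomial.eval_one]
  rfl

lemma deriv_zero_of_skew {n : ℕ} (e : ESp n) (p q : Polynomial ℂ) (r : ℂ)
    {B : Matrix (Fin n) (Fin n) ℂ} (hB : Bᵀ = -B) (hB0 : B ≠ 0)
    (hBM : B * lmat e (p.eval r) 1 (q.eval r) = 0) :
    (Polynomial.derivative (hev (Phi e) p 1 q)).eval r = 0 := by
  rw [hev_Phi, derivative_det_row, Polynomial.eval_finsetSum]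
  refine Finset.sum_eq_zero fun l _ => ?_
  rw [← Polynomial.coe_evalRingHom, RingHom.map_det]
  have h := det_updateRow_of_skew hB hB0 (skew_diag hB) hBM l
    (fun i => (Polynomial.derivative (lmat e p 1 q l i)).eval r)
  rw [← h, ← eval_lmat]
  congr 1
  ext i j
  by_cases hil : i = l
  · subst hil; simp
  · simp [Matrix.updateRow_ne hil]

lemma bad_of_skew {n : ℕ} (hn : 0 < n) {e : ESp n} {z t : ℂ} (hz : 0 < z.im)
    {B : Matrix (Fin n) (Fin n) ℂ} (hB : Bᵀ = -B) (hB0 : B ≠ 0) (hBM : B * lmat e z 1 t = 0) :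
    BadC (Phi e) := by
  refine ⟨z, t, hz, ?_, ?_, ?_⟩
  · rw [hev_Phi]
    have h := det_updateRow_of_skew hB hB0 (skew_diag hB) hBM ⟨0, hn⟩ (lmat e z 1 t ⟨0, hn⟩)
    rwa [Matrix.updateRow_eq_self] at h
  · rw [← hdx_eq]
    exact deriv_zero_of_skew e _ _ z hB hB0 (by simpa using hBM)
  · rw [← hdt_eq]
    exact deriv_zero_of_skew e _ _ t hB hB0 (by simpa using hBM)

lemma conj_lmat {n : ℕ} (e : ESp n) (z t : ℂ) :
    (lmat e z 1 t).map (starRingEnd ℂ) = lmat e (starRingEnd ℂ z) 1 (starRingEnd ℂ t) := by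
  ext i j
  rw [Matrix.map_apply, lmat_apply, lmat_apply]; simp

lemma bad_of_not_good {n : ℕ} {e : ESp n} (he : StrC (Phi e)) (hg : ¬ Good e) :
    3 ≤ n ∧ BadC (Phi e) := by
  have hinj := he.injective
  unfold Good at hg
  push Not at hg
  obtain ⟨z, t, B, hB, hBM, hB0⟩ := hg hinj
  have hzim : z.im ≠ 0 := by
    intro h0
    apply hB0
    have hz : z = (z.re : ℂ) := by apply Complex.ext <;> simp [h0]
    rw [hz] at hBM
    exact he.skew_one z.re t hB hBM
  have hn3 : 3 ≤ n := by
    by_contra hlt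
    push Not at hlt
    apply hB0
    interval_cases n
    · ext i; exact i.elim0
    · ext i j
      have : j = i := Subsingleton.elim _ _
      subst this
      simpa using skew_diag hB j
    · have h00 := skew_diag hB 0
      have h11 := skew_diag hB 1
      have h10 : B 1 0 = - B 0 1 := by simpa using congrFun (congrFun hB 0) 1
      have a1 := congrFun (congrFun hBM 0) 1
      have a2 := congrFun (congrFun hBM 1) 0
      simp only [Matrix.mul_apply, Fin.sum_univ_two, h00, h11, h10, Matrix.zero_apply, zero_mul,
        zero_add, add_zero, neg_mul, neg_eq_zero] at a1 a2
      have hb : B 0 1 = 0 := by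
        by_contra hb
        have b1 := (mul_eq_zero.1 a1).resolve_left hb
        have b2 := (mul_eq_zero.1 a2).resolve_left hb
        rw [lmat_apply] at b1 b2
        have b3 := congrArg Complex.im (b1.trans b2.symm)
        simp at b3
        rcases b3 with b3 | b3
        · exact absurd (hinj b3) (by decide)
        · exact hzim b3
      ext i j
      fin_cases i <;> fin_cases j <;> simp [h00, h11, h10, hb]
  refine ⟨hn3, ?_⟩
  rcases lt_or_gt_of_ne hzim with hlt | hgt
  · have hBM' : B.map (starRingEnd ℂ) * lmat e (starRingEnd ℂ z) 1 (starRingEnd ℂ t) = 0 := by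
      rw [← conj_lmat, ← Matrix.map_mul, hBM]
      ext i j; simp
    refine bad_of_skew (by omega) (by simpa using hlt) ?_ ?_ hBM'
    · rw [← Matrix.transpose_map, hB]
      ext i j; simp
    · intro h0
      apply hB0
      ext i j
      simpa using congrFun (congrFun h0 i) j
  · exact bad_of_skew (by omega) hgt hB hB0 hBM

/-! ### Parametrization of the bad set -/

lemma solve_six {a b w00 w01 w02 w03 w10 w11 : ℝ} (hb : b ≠ 0) {z t H Hx Ht : ℂ}
    (hz : z = ⟨a, b⟩)
    (h1 : H + (w00 + w01 * z + w02 * z ^ 2 + w03 * z ^ 3 + t * (w10 + w11 * z)) = 0)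
    (h2 : Hx + (w01 + 2 * w02 * z + 3 * w03 * z ^ 2 + t * w11) = 0)
    (h3 : Ht + (w10 + w11 * z) = 0) :
    w11 = - Ht.im * b⁻¹ ∧ w10 = - Ht.re - a * w11 ∧
    w03 = ((- H + t * Ht).im * b⁻¹ - (- Hx - t * w11).re) * (b⁻¹ * b⁻¹) / 2 ∧
    w02 = (- Hx - t * w11).im * b⁻¹ / 2 - 3 * a * w03 ∧
    w01 = (- Hx - t * w11).re - 2 * a * w02 - 3 * (a ^ 2 - b ^ 2) * w03 ∧
    w00 = (- H + t * Ht).re - a * w01 - (a ^ 2 - b ^ 2) * w02 - (a ^ 3 - 3 * a * b ^ 2) * w03 := by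
  have hz2 : z ^ 2 = ⟨a ^ 2 - b ^ 2, 2 * a * b⟩ := by
    rw [hz, sq]; apply Complex.ext <;> simp <;> ring
  have hz3 : z ^ 3 = ⟨a ^ 3 - 3 * a * b ^ 2, 3 * a ^ 2 * b - b ^ 3⟩ := by
    rw [pow_succ, hz2, hz]; apply Complex.ext <;> simp <;> ring
  have e1 : - H + t * Ht = w00 + w01 * z + w02 * z ^ 2 + w03 * z ^ 3 := by
    linear_combination (-1 : ℂ) * h1 + t * h3
  have e2 : - Hx - t * w11 = w01 + 2 * w02 * z + 3 * w03 * z ^ 2 := by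
    linear_combination (-1 : ℂ) * h2
  have e3 : Ht = - (w10 + w11 * z) := by linear_combination h3
  have r1 : (- H + t * Ht).re = w00 + w01 * a + w02 * (a ^ 2 - b ^ 2) + w03 * (a ^ 3 - 3 * a * b ^ 2) := by
    rw [e1, hz2, hz3, hz]; simp
  have i1 : (- H + t * Ht).im = w01 * b + w02 * (2 * a * b) + w03 * (3 * a ^ 2 * b - b ^ 3) := by
    rw [e1, hz2, hz3, hz]; simp
  have r2 : (- Hx - t * w11).re = w01 + 2 * w02 * a + 3 * w03 * (a ^ 2 - b ^ 2) := by
    rw [e2, hz2, hz]; simp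
  have i2 : (- Hx - t * w11).im = 2 * w02 * b + 3 * w03 * (2 * a * b) := by
    rw [e2, hz2, hz]; simp
  have r3 : Ht.re = - (w10 + w11 * a) := by rw [e3, hz]; simp
  have i3 : Ht.im = - (w11 * b) := by rw [e3, hz]; simp
  rw [r1, i1, r2, i2, r3, i3]
  refine ⟨?_, ?_, ?_, ?_, ?_, ?_⟩
  · field_simp
  · ring
  · field_simp; ring
  · field_simp; ring
  · ring
  · ring

/-- The six special indices. -/
def idx6 {n : ℕ} (hn : 3 ≤ n) : Fin 6 → LIdx n :=
  ![⟨⟨0, by omega⟩, ⟨0, by omega⟩⟩, ⟨⟨0, by omega⟩, ⟨1, by simp; omega⟩⟩,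
    ⟨⟨0, by omega⟩, ⟨2, by simp; omega⟩⟩, ⟨⟨0, by omega⟩, ⟨3, by simp; omega⟩⟩,
    ⟨⟨1, by omega⟩, ⟨0, by omega⟩⟩, ⟨⟨1, by omega⟩, ⟨1, by simp; omega⟩⟩]

lemma idx6_inj {n : ℕ} (hn : 3 ≤ n) : Function.Injective (idx6 hn) := by
  intro i j h
  have h1 : ((idx6 hn i).1 : ℕ) = (idx6 hn j).1 := by rw [h]
  have h2 : ((idx6 hn i).2 : ℕ) = (idx6 hn j).2 := by rw [h]
  fin_cases i <;> fin_cases j <;> simp [idx6] at h1 h2 ⊢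

/-- Remaining indices. -/
abbrev RIdx {n : ℕ} (hn : 3 ≤ n) : Type := {p : LIdx n // p ∉ Set.range (idx6 hn)}

open Classical in
/-- Extension by zero. -/
def ext0 {n : ℕ} (hn : 3 ≤ n) (g : RIdx hn → ℝ) : LCoef n :=
  fun p => if h : p ∈ Set.range (idx6 hn) then 0 else g ⟨p, h⟩

lemma sum_split {n : ℕ} (hn : 3 ≤ n) (c : LCoef n) (f : LIdx n → ℂ) :
    ∑ p, (c p : ℂ) * f p = ∑ p, ((ext0 hn (fun q => c q.1) p : ℝ) : ℂ) * f p +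
      ∑ i, (c (idx6 hn i) : ℂ) * f (idx6 hn i) := by
  classical
  have h1 : ∑ i, (c (idx6 hn i) : ℂ) * f (idx6 hn i) =
      ∑ p, if p ∈ Set.range (idx6 hn) then (c p : ℂ) * f p else 0 := by
    rw [← Finset.sum_filter]
    symm
    have : (Finset.univ.filter fun p => p ∈ Set.range (idx6 hn)) = Finset.univ.image (idx6 hn) := by
      ext p; simp
    rw [this, Finset.sum_image fun i _ j _ h => idx6_inj hn h]
  rw [h1, ← Finset.sum_add_distrib]
  refine Finset.sum_congr rfl fun p _ => ?_
  by_cases h : p ∈ Set.range (idx6 hn)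
  · simp [ext0, h]
  · simp only [ext0, h, dif_neg, not_false_eq_true, if_false, add_zero]

lemma bad_eqs {n : ℕ} (hn : 3 ≤ n) (c : LCoef n) (z t : ℂ) :
    let g := ext0 hn (fun q => c q.1)
    let w := fun i => c (idx6 hn i)
    hev c z 1 t = hev g z 1 t + (w 0 + w 1 * z + w 2 * z ^ 2 + w 3 * z ^ 3 + t * (w 4 + w 5 * z)) ∧
    hdx c z t = hdx g z t + (w 1 + 2 * w 2 * z + 3 * w 3 * z ^ 2 + t * w 5) ∧
    hdt c z t = hdt g z t + (w 4 + w 5 * z) := by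
  intro g w
  refine ⟨?_, ?_, ?_⟩
  · simp only [hev, Complex.coe_algebraMap]
    rw [sum_split hn, ← add_assoc]
    congr 1
    simp [Fin.sum_univ_succ, idx6, w, Fin.succ]
    ring
  · simp only [hdx]
    rw [sum_split hn]
    congr 1
    simp [Fin.sum_univ_succ, idx6, w, Fin.succ]
    ring
  · simp only [hdt]
    rw [sum_split hn, ← add_assoc]
    congr 1
    simp [Fin.sum_univ_succ, idx6, w, Fin.succ]

/-- Parameter space for the bad set. -/
abbrev BSp {n : ℕ} (hn : 3 ≤ n) : Type := (Fin 4 → ℝ) × (RIdx hn → ℝ)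

lemma finrank_BSp {n : ℕ} (hn : 3 ≤ n) :
    Module.finrank ℝ (BSp hn) + 2 = Module.finrank ℝ (LCoef n) := by
  classical
  rw [Module.finrank_prod, Module.finrank_fintype_fun_eq_card, Module.finrank_fintype_fun_eq_card,
    Module.finrank_fintype_fun_eq_card]
  have h1 : Fintype.card (RIdx hn) + 6 = Fintype.card (LIdx n) := by
    have h2 := Fintype.card_subtype_compl (fun p : LIdx n => p ∈ Set.range (idx6 hn))
    have h3 : Fintype.card {p : LIdx n // p ∈ Set.range (idx6 hn)} = 6 := by
      rw [← Nat.card_eq_fintype_card]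
      have := Nat.card_range_of_injective (idx6_inj hn)
      rw [Nat.card_eq_fintype_card (α := Fin 6), Fintype.card_fin] at this
      exact this
    have h4 := Fintype.card_subtype_le (fun p : LIdx n => p ∈ Set.range (idx6 hn))
    rw [h3] at h2 h4
    have h5 : Fintype.card (RIdx hn) = Fintype.card (LIdx n) - 6 := by
      rw [← h2]
    omega
  rw [Fintype.card_fin]
  omega

lemma exists_param {n : ℕ} (hn : 3 ≤ n) :
    ∃ Ψ : BSp hn → LCoef n, ContDiff ℝ ⊤ Ψ ∧ ∀ c, BadC c → c ∈ Set.range Ψ := by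
  classical
  let a : BSp hn → ℝ := fun w => w.1 0
  let b : BSp hn → ℝ := fun w => Real.exp (w.1 1)
  let bi : BSp hn → ℝ := fun w => Real.exp (- w.1 1)
  let z : BSp hn → ℂ := fun w => (a w : ℂ) + (b w : ℂ) * I
  let t : BSp hn → ℂ := fun w => (w.1 2 : ℂ) + (w.1 3 : ℂ) * I
  let H : BSp hn → ℂ := fun w => hev (ext0 hn w.2) (z w) 1 (t w)
  let Hx : BSp hn → ℂ := fun w => hdx (ext0 hn w.2) (z w) (t w)
  let Ht : BSp hn → ℂ := fun w => hdt (ext0 hn w.2) (z w) (t w)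
  have hco : ∀ {f : BSp hn → ℝ}, ContDiff ℝ ⊤ f → ContDiff ℝ ⊤ fun w => (f w : ℂ) :=
    fun hf => Complex.ofRealCLM.contDiff.comp hf
  have hre : ∀ {f : BSp hn → ℂ}, ContDiff ℝ ⊤ f → ContDiff ℝ ⊤ fun w => (f w).re :=
    fun hf => Complex.reCLM.contDiff.comp hf
  have him : ∀ {f : BSp hn → ℂ}, ContDiff ℝ ⊤ f → ContDiff ℝ ⊤ fun w => (f w).im :=
    fun hf => Complex.imCLM.contDiff.comp hf
  have hcoord : ∀ i, ContDiff ℝ ⊤ fun w : BSp hn => w.1 i := fun i =>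
    contDiff_pi.1 (contDiff_fst (E := Fin 4 → ℝ) (F := RIdx hn → ℝ)) i
  have hext : ∀ p, ContDiff ℝ ⊤ fun w : BSp hn => ext0 hn w.2 p := by
    intro p
    unfold ext0
    split_ifs with h
    · exact contDiff_const
    · exact contDiff_pi.1 (contDiff_snd (E := Fin 4 → ℝ) (F := RIdx hn → ℝ)) _
  have ca : ContDiff ℝ ⊤ a := hcoord 0
  have cb : ContDiff ℝ ⊤ b := (hcoord 1).exp
  have cbi : ContDiff ℝ ⊤ bi := (hcoord 1).neg.exp
  have cz : ContDiff ℝ ⊤ z := (hco ca).add ((hco cb).mul contDiff_const)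
  have ct : ContDiff ℝ ⊤ t := (hco (hcoord 2)).add ((hco (hcoord 3)).mul contDiff_const)
  have cH : ContDiff ℝ ⊤ H := by
    refine (ct.pow n).add (ContDiff.sum fun p _ => (hco (hext p)).mul (((cz.pow _).mul ?_).mul (ct.pow _)))
    exact contDiff_const
  have cHx : ContDiff ℝ ⊤ Hx :=
    ContDiff.sum fun p _ => (hco (hext p)).mul ((contDiff_const.mul (cz.pow _)).mul (ct.pow _))
  have cHt : ContDiff ℝ ⊤ Ht :=
    (contDiff_const.mul (ct.pow _)).add
      (ContDiff.sum fun p _ => (hco (hext p)).mul ((cz.pow _).mul (contDiff_const.mul (ct.pow _))))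
  let w11 : BSp hn → ℝ := fun w => - (Ht w).im * bi w
  let w10 : BSp hn → ℝ := fun w => - (Ht w).re - a w * w11 w
  let R : BSp hn → ℂ := fun w => - H w + t w * Ht w
  let Q : BSp hn → ℂ := fun w => - Hx w - t w * w11 w
  let w03 : BSp hn → ℝ := fun w => ((R w).im * bi w - (Q w).re) * (bi w * bi w) / 2
  let w02 : BSp hn → ℝ := fun w => (Q w).im * bi w / 2 - 3 * a w * w03 w
  let w01 : BSp hn → ℝ := fun w => (Q w).re - 2 * a w * w02 w - 3 * (a w ^ 2 - b w ^ 2) * w03 w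
  let w00 : BSp hn → ℝ := fun w => (R w).re - a w * w01 w - (a w ^ 2 - b w ^ 2) * w02 w -
    (a w ^ 3 - 3 * a w * b w ^ 2) * w03 w
  have c11 : ContDiff ℝ ⊤ w11 := (him cHt).neg.mul cbi
  have c10 : ContDiff ℝ ⊤ w10 := (hre cHt).neg.sub (ca.mul c11)
  have cR : ContDiff ℝ ⊤ R := cH.neg.add (ct.mul cHt)
  have cQ : ContDiff ℝ ⊤ Q := cHx.neg.sub (ct.mul (hco c11))
  have c03 : ContDiff ℝ ⊤ w03 := ((((him cR).mul cbi).sub (hre cQ)).mul (cbi.mul cbi)).div_const 2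
  have c02 : ContDiff ℝ ⊤ w02 :=
    (((him cQ).mul cbi).div_const 2).sub ((contDiff_const.mul ca).mul c03)
  have c01 : ContDiff ℝ ⊤ w01 := ((hre cQ).sub ((contDiff_const.mul ca).mul c02)).sub
    ((contDiff_const.mul ((ca.pow 2).sub (cb.pow 2))).mul c03)
  have c00 : ContDiff ℝ ⊤ w00 := (((hre cR).sub (ca.mul c01)).sub
    (((ca.pow 2).sub (cb.pow 2)).mul c02)).sub
    (((ca.pow 3).sub ((contDiff_const.mul ca).mul (cb.pow 2))).mul c03)
  let W : Fin 6 → BSp hn → ℝ := ![w00, w01, w02, w03, w10, w11]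
  have cW : ∀ i, ContDiff ℝ ⊤ (W i) := by
    intro i
    fin_cases i
    exacts [c00, c01, c02, c03, c10, c11]
  refine ⟨fun w p => if h : p ∈ Set.range (idx6 hn) then W h.choose w else w.2 ⟨p, h⟩, ?_, ?_⟩
  · refine contDiff_pi.2 fun p => ?_
    split_ifs with h
    · exact cW _
    · exact contDiff_pi.1 (contDiff_snd (E := Fin 4 → ℝ) (F := RIdx hn → ℝ)) _
  · rintro c ⟨z0, t0, hz0, h1, h2, h3⟩
    let w : BSp hn := (![z0.re, Real.log z0.im, t0.re, t0.im], fun q => c q.1)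
    have eb : b w = z0.im := by simp [b, w, Real.exp_log hz0]
    have ebi : bi w = (z0.im)⁻¹ := by simp [bi, w, Real.exp_neg, Real.exp_log hz0]
    have ea : a w = z0.re := by simp [a, w]
    have ez : z w = z0 := by simp only [z, ea, eb]; exact Complex.re_add_im z0
    have et : t w = t0 := by simp [t, w]
    have key := bad_eqs hn c z0 t0
    simp only at key
    obtain ⟨k1, k2, k3⟩ := key
    rw [k1] at h1
    rw [k2] at h2
    rw [k3] at h3
    obtain ⟨s1, s2, s3, s4, s5, s6⟩ := solve_six (a := z0.re) (b := z0.im) 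
      hz0.ne' rfl h1 h2 h3
    have eH : H w = hev (ext0 hn (fun q => c q.1)) z0 1 t0 := by simp only [H, ez, et, w]
    have eHx : Hx w = hdx (ext0 hn (fun q => c q.1)) z0 t0 := by simp only [Hx, ez, et, w]
    have eHt : Ht w = hdt (ext0 hn (fun q => c q.1)) z0 t0 := by simp only [Ht, ez, et, w]
    rw [← eHt, ← ebi] at s1
    have f1 : c (idx6 hn 5) = w11 w := s1
    rw [f1, ← eHt, ← ea] at s2
    have f2 : c (idx6 hn 4) = w10 w := s2
    rw [← eH, ← eHt, ← eHx, ← et, f1, ← ebi] at s3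
    have f3 : c (idx6 hn 3) = w03 w := s3
    rw [← eHx, ← et, f1, ← ebi, f3, ← ea] at s4
    have f4 : c (idx6 hn 2) = w02 w := s4
    rw [← eHx, ← et, f1, f3, f4, ← ea, ← eb] at s5
    have f5 : c (idx6 hn 1) = w01 w := s5
    rw [← eH, ← eHt, ← et, f3, f4, f5, ← ea, ← eb] at s6
    have f6 : c (idx6 hn 0) = w00 w := s6
    have fW : ∀ i, c (idx6 hn i) = W i w := by
      intro i
      fin_cases i
      exacts [f6, f5, f4, f3, f2, f1]
    refine ⟨w, ?_⟩
    ext p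
    dsimp only
    split_ifs with h
    · rw [← fW, h.choose_spec]
    · rfl

/-! ### A good point -/

/-- A Jacobi pencil. -/
def jac (n : ℕ) : ESp n :=
  (fun i => ((i : ℕ) : ℝ), Sym2.lift ⟨fun i j : Fin n =>
    if (i : ℕ) + 1 = j ∨ (j : ℕ) + 1 = i then (1 : ℝ) else 0, fun i j => by
      simp only [or_comm]⟩)

lemma symM_jac {n : ℕ} (i j : Fin n) :
    symM (jac n).2 i j = if (i : ℕ) + 1 = j ∨ (j : ℕ) + 1 = i then (1 : ℝ) else 0 := rfl

lemma jac_row {n : ℕ} (z t : ℂ) (r : Fin n → ℂ) (h0 : ∀ i : Fin n, (i : ℕ) = 0 → r i = 0)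
    (hr : r ᵥ* lmat (jac n) z 1 t = 0) : r = 0 := by
  have key : ∀ m : ℕ, ∀ i : Fin n, (i : ℕ) ≤ m → r i = 0 := by
    intro m
    induction m with
    | zero => intro i hi; exact h0 i (by omega)
    | succ m ih =>
      intro i hi
      rcases Nat.lt_or_ge (i : ℕ) (m + 1) with h | h
      · exact ih i (by omega)
      · have him : (i : ℕ) = m + 1 := by omega
        have hm : m < n := by have := i.2; omega
        have h1 := congrFun hr ⟨m, hm⟩
        simp only [Matrix.vecMul, dotProduct, Pi.zero_apply] at h1
        rw [Finset.sum_eq_single i] at h1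
        · have h2 : lmat (jac n) z 1 t i ⟨m, hm⟩ = 1 := by
            have hne : i ≠ ⟨m, hm⟩ := by
              intro h; rw [h] at him; simp at him
            rw [lmat_apply, symM_jac, Matrix.diagonal_apply_ne _ hne, Matrix.one_apply_ne hne]
            simp [him]
          rwa [h2, mul_one] at h1
        · intro k _ hk
          rcases Nat.lt_or_ge (k : ℕ) (m + 1) with h' | h'
          · rw [ih k (by omega), zero_mul]
          · have hk2 : (k : ℕ) ≠ i := fun h => hk (Fin.ext h)
            have hne : k ≠ ⟨m, hm⟩ := by
              intro h; rw [h] at h'; simp at h'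
            rw [lmat_apply, symM_jac, Matrix.diagonal_apply_ne _ hne, Matrix.one_apply_ne hne]
            rw [if_neg]
            · simp
            · simp only
              omega
        · intro h; exact absurd (Finset.mem_univ _) h
  ext i
  exact key i i le_rfl

lemma good_jac (n : ℕ) : Good (jac n) := by
  constructor
  · intro i j h
    simp only [jac] at h
    exact Fin.ext (by exact_mod_cast h)
  · intro z t B hB hBM
    have hrow : ∀ i, B i ᵥ* lmat (jac n) z 1 t = 0 := fun i => by
      ext j
      exact congrFun (congrFun hBM i) j
    have hz : ∀ i : Fin n, (i : ℕ) = 0 → B i = 0 := by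
      intro i hi
      apply jac_row z t _ _ (hrow i)
      intro j hj
      have : j = i := Fin.ext (by omega)
      rw [this]
      exact skew_diag hB i
    ext i j
    have : B i = 0 := by
      apply jac_row z t _ _ (hrow i)
      intro j hj
      have h1 := congrFun (congrFun hB i) j
      rw [Matrix.transpose_apply, Matrix.neg_apply, hz j hj] at h1
      simpa using h1
    rw [this]; rfl

/-! ### The Jacobian -/

lemma exists_jacobian (n : ℕ) : ∃ J : ESp n → ℝ, ContDiff ℝ ⊤ J ∧
    ∀ e, J e ≠ 0 ↔ Function.Injective (fderiv ℝ Phi e) := by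
  have hfr : Module.finrank ℝ (LCoef n) = Module.finrank ℝ (ESp n) := by
    rw [finrank_LCoef, finrank_ESp]
  let L : LCoef n ≃L[ℝ] ESp n := ContinuousLinearEquiv.ofFinrankEq hfr
  let b := Module.finBasis ℝ (ESp n)
  let T : ESp n → (ESp n →ₗ[ℝ] ESp n) := fun e =>
    (L : LCoef n →ₗ[ℝ] ESp n) ∘ₗ (fderiv ℝ Phi e : ESp n →ₗ[ℝ] LCoef n)
  refine ⟨fun e => (LinearMap.toMatrix b b (T e)).det, ?_, ?_⟩
  · have hfd : ContDiff ℝ ⊤ (fderiv ℝ (Phi : ESp n → LCoef n)) :=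
      (contDiff_Phi n).fderiv_right le_rfl
    have hent : ∀ i j, ContDiff ℝ ⊤ fun e => LinearMap.toMatrix b b (T e) i j := by
      intro i j
      have h1 : ContDiff ℝ ⊤ fun e => fderiv ℝ Phi e (b j) := hfd.clm_apply contDiff_const
      have h2 : ContDiff ℝ ⊤ fun e => L (fderiv ℝ Phi e (b j)) := L.contDiff.comp h1
      have h3 : ContDiff ℝ ⊤ fun e => (LinearMap.toContinuousLinearMap (b.coord i)) (L (fderiv ℝ Phi e (b j))) :=
        (LinearMap.toContinuousLinearMap (b.coord i)).contDiff.comp h2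
      have h4 : (fun e => LinearMap.toMatrix b b (T e) i j) =
          fun e => (LinearMap.toContinuousLinearMap (b.coord i)) (L (fderiv ℝ Phi e (b j))) := by
        ext e
        rw [LinearMap.toMatrix_apply]
        rfl
      rw [h4]
      exact h3
    simp only [Matrix.det_apply']
    refine ContDiff.sum fun σ _ => contDiff_const.mul ?_
    exact contDiff_prod fun i _ => hent _ _
  · intro e
    dsimp only
    rw [LinearMap.det_toMatrix, Ne, LinearMap.det_eq_zero_iff_ker_ne_bot, not_not, LinearMap.ker_eq_bot]
    have : (T e : ESp n → ESp n) = L ∘ (fderiv ℝ Phi e) := rfl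
    rw [this]
    exact L.injective.of_comp_iff _

lemma interior_of_injective {n : ℕ} {e : ESp n} (h : Function.Injective (fderiv ℝ Phi e)) :
    Phi e ∈ interior (Set.range (Phi : ESp n → LCoef n)) := by
  have hfr : Module.finrank ℝ (ESp n) = Module.finrank ℝ (LCoef n) := by
    rw [finrank_LCoef, finrank_ESp]
  have hs : Function.Surjective (fderiv ℝ (Phi : ESp n → LCoef n) e) :=
    (LinearMap.injective_iff_surjective_of_finrank_eq_finrank (f := (fderiv ℝ Phi e : ESp n →ₗ[ℝ] LCoef n)) hfr).1 h
  have hst : HasStrictFDerivAt (Phi : ESp n → LCoef n) (fderiv ℝ Phi e) e :=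
    (contDiff_Phi n).contDiffAt.hasStrictFDerivAt (by simp)
  have hmap := hst.map_nhds_eq_of_surj (LinearMap.range_eq_top.2 hs)
  rw [mem_interior_iff_mem_nhds, ← hmap]
  exact Filter.range_mem_map

lemma exists_near {n : ℕ} (e0 : ESp n) {N : Set (ESp n)} (hN : N ∈ nhds e0) :
    ∃ e ∈ N, Function.Injective (fderiv ℝ Phi e) := by
  obtain ⟨J, hJ, hJi⟩ := exists_jacobian n
  by_contra hcon
  push Not at hcon
  let g : ℝ → ESp n := fun s => e0 + s • (jac n - e0)
  have hg : ContDiff ℝ ⊤ g := contDiff_const.add (contDiff_id.smul contDiff_const)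
  have hj : ContDiff ℝ ⊤ (J ∘ g) := hJ.comp hg
  have ha : AnalyticOnNhd ℝ (J ∘ g) Set.univ := by
    intro x _
    exact contDiff_omega_iff_analyticOnNhd.1 hj x (Set.mem_univ _)
  have hg0 : g 0 = e0 := by simp [g]
  have hev : ∀ᶠ s in nhds (0 : ℝ), (J ∘ g) s = 0 := by
    have : g ⁻¹' N ∈ nhds (0 : ℝ) := hg.continuous.continuousAt.preimage_mem_nhds (by rwa [hg0])
    filter_upwards [this] with s hs
    by_contra h
    exact hcon _ hs ((hJi _).1 h)
  have h1 := ha.eqOn_zero_of_preconnected_of_eventuallyEq_zero isPreconnected_univ (Set.mem_univ 0) hev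
    (Set.mem_univ (1 : ℝ))
  have hg1 : g 1 = jac n := by simp [g]
  simp only [Function.comp, hg1, Pi.zero_apply] at h1
  exact (hJi _).2 (good_jac n).injective_fderiv h1

/-! ### Openness -/

lemma meets_frontier {X : Type*} [TopologicalSpace X] {S U : Set X} (hS : IsPreconnected S)
    (h1 : (S ∩ U).Nonempty) (h2 : (S ∩ Uᶜ).Nonempty) : (S ∩ frontier U).Nonempty := by
  by_contra hcon
  rw [Set.not_nonempty_iff_eq_empty] at hcon
  have hnot : ∀ x ∈ S, x ∉ frontier U := fun x hx hf => by
    have : x ∈ S ∩ frontier U := ⟨hx, hf⟩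
    rw [hcon] at this
    exact this
  obtain ⟨x, hx, hxU⟩ := h1
  obtain ⟨y, hy, hyU⟩ := h2
  have hcl : ∀ x ∈ S, x ∈ closure U → x ∈ interior U := fun x hx hc => by
    by_contra hi
    exact hnot x hx ⟨hc, hi⟩
  obtain ⟨w, _, hw1, hw2⟩ := hS (interior U) (closure U)ᶜ isOpen_interior isClosed_closure.isOpen_compl
    (fun w hw => by
      by_cases h : w ∈ closure U
      · exact Or.inl (hcl w hw h)
      · exact Or.inr h)
    ⟨x, hx, hcl x hx (subset_closure hxU)⟩
    ⟨y, hy, fun h => hyU (interior_subset (hcl y hy h))⟩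
  exact hw2 (interior_subset_closure hw1)

lemma open_range {n : ℕ} {c : LCoef n} (hc : StrC c) (hcU : c ∈ Set.range (Phi : ESp n → LCoef n)) :
    c ∈ interior (Set.range (Phi : ESp n → LCoef n)) := by
  set U := Set.range (Phi : ESp n → LCoef n) with hU
  have hUc : IsClosed U := isClosed_range_Phi n
  by_contra hnotint
  obtain ⟨r, hr, hball⟩ := Metric.isOpen_iff.1 (isOpen_StrC n) c hc
  obtain ⟨e0, he0⟩ := hcU
  have hN : (Phi : ESp n → LCoef n) ⁻¹' (Metric.ball c r) ∈ nhds e0 :=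
    (contDiff_Phi n).continuous.continuousAt.preimage_mem_nhds (by
      rw [he0]; exact Metric.ball_mem_nhds c hr)
  obtain ⟨e, heN, hei⟩ := exists_near e0 hN
  set p := Phi e with hp
  have hpi : p ∈ interior U := interior_of_injective hei
  have hpb : p ∈ Metric.ball c r := heN
  have hB2 : IsOpen (Metric.ball c r ∩ Uᶜ) := Metric.isOpen_ball.inter hUc.isOpen_compl
  have hB2n : (Metric.ball c r ∩ Uᶜ).Nonempty := by
    by_contra hemp
    apply hnotint
    rw [mem_interior]
    refine ⟨Metric.ball c r, fun q hq => ?_, Metric.isOpen_ball, Metric.mem_ball_self hr⟩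
    by_contra hqU
    exact hemp ⟨q, hq, hqU⟩
  have key : ∀ q ∈ Metric.ball c r ∩ Uᶜ, 3 ≤ n ∧ ∃ w : LCoef n, ∃ ν : ℝ, BadC w ∧ q = p + ν • (w - p) := by
    rintro q ⟨hq, hqU⟩
    have hseg : segment ℝ p q ⊆ Metric.ball c r := (convex_ball c r).segment_subset hpb hq
    have hpre : IsPreconnected (segment ℝ p q) := (convex_segment p q).isPreconnected
    obtain ⟨w, hws, hwf⟩ := meets_frontier hpre
      ⟨p, left_mem_segment ℝ p q, interior_subset hpi⟩ ⟨q, right_mem_segment ℝ p q, hqU⟩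
    have hwU : w ∈ U := hUc.frontier_subset hwf
    have hwi : w ∉ interior U := hwf.2
    have hwS : StrC w := hball (hseg hws)
    obtain ⟨e', he'⟩ := hwU
    have hng : ¬ Good e' := by
      intro hgood
      apply hwi
      rw [← he']
      exact interior_of_injective hgood.injective_fderiv
    rw [← he'] at hwS
    have hbad := bad_of_not_good hwS hng
    rw [he'] at hbad
    refine ⟨hbad.1, w, ?_⟩
    rw [segment_eq_image'] at hws
    obtain ⟨μ, _, hμ⟩ := hws
    simp only at hμ
    have hμ0 : μ ≠ 0 := by
      rintro rfl
      apply hwi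
      rw [← hμ]
      simpa using hpi
    refine ⟨μ⁻¹, hbad.2, ?_⟩
    rw [← hμ, add_sub_cancel_left, smul_smul, inv_mul_cancel₀ hμ0, one_smul, add_sub_cancel]
  obtain ⟨q0, hq0⟩ := hB2n
  have hn := (key q0 hq0).1
  obtain ⟨Ψ, hΨ, hΨr⟩ := exists_param hn
  let Θ : BSp hn × ℝ → LCoef n := fun v => p + v.2 • (Ψ v.1 - p)
  have hΘ : ContDiff ℝ ⊤ Θ :=
    contDiff_const.add (contDiff_snd.smul ((hΨ.comp contDiff_fst).sub contDiff_const))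
  have hfin : Module.finrank ℝ (BSp hn × ℝ) < Module.finrank ℝ (LCoef n) := by
    rw [← finrank_BSp hn, Module.finrank_prod, Module.finrank_self]
    omega
  have hdense := (hΘ.of_le le_top : ContDiff ℝ 1 Θ).dense_compl_range_of_finrank_lt_finrank hfin
  obtain ⟨q, hq, hqr⟩ := hdense.inter_open_nonempty _ hB2 ⟨q0, hq0⟩
  obtain ⟨w, ν, hw, hqe⟩ := (key q hq).2
  obtain ⟨v, hv⟩ := hΨr w hw
  apply hqr
  refine ⟨(v, ν), ?_⟩
  simp only [Θ, hv]
  exact hqe.symm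

lemma connect {n : ℕ} {S : Set (LCoef n)} (hS : IsPreconnected S) (hSV : ∀ c ∈ S, StrC c)
    (hne : (S ∩ Set.range (Phi : ESp n → LCoef n)).Nonempty) :
    S ⊆ Set.range (Phi : ESp n → LCoef n) := by
  intro c hc
  by_contra hcU
  obtain ⟨w, hwS, hwf⟩ := meets_frontier hS hne ⟨c, hc, hcU⟩
  exact hwf.2 (open_range (hSV w hwS) ((isClosed_range_Phi n).frontier_subset hwf))

/-- The Lax conjecture in three variables (Helton–Vinnikov). -/
theorem helton_vinnikov {n : ℕ} (hn : 0 < n) {c : LCoef n} (hc : HypC c) :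
    c ∈ Set.range (Phi : ESp n → LCoef n) := by
  set U := Set.range (Phi : ESp n → LCoef n) with hU
  set f : LCoef n := Phi (jac n) with hf
  have hfh : HypC f := hyp_Phi _
  have hfi : f ∈ interior U := interior_of_injective (good_jac n).injective_fderiv
  have hcont : ∀ c : LCoef n, Continuous fun s : ℝ => nuij s c := by
    intro c
    have h0 : Continuous fun s : ℝ => (s, c) := continuous_id.prodMk continuous_const
    have h1 := (continuous_nuij n).comp h0
    exact h1
  have hpath : ∀ c : LCoef n, ∀ s : ℝ, Continuous fun l : ℝ => nuij s (scL l c) := by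
    intro c s
    have h0 : Continuous fun l : ℝ => (s, scL l c) := continuous_const.prodMk (continuous_scL c)
    have h1 := (continuous_nuij n).comp h0
    exact h1
  have hpathS : ∀ c : LCoef n, HypC c → ∀ s : ℝ, s ≠ 0 →
      ∀ w ∈ Set.range (fun l : ℝ => nuij s (scL l c)), StrC w := by
    rintro c hc s hs _ ⟨l, rfl⟩
    exact nuij_str hn hs (hc.scL l)
  have h1 : ∀ᶠ s in nhds (0 : ℝ), nuij s f ∈ U := by
    have h0 : U ∈ nhds (nuij 0 f) := by
      rw [nuij_zero]; exact mem_interior_iff_mem_nhds.1 hfi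
    exact (hcont f).continuousAt.preimage_mem_nhds h0
  have h2 : ∀ᶠ s in nhdsWithin (0 : ℝ) {0}ᶜ, nuij s c ∈ U := by
    filter_upwards [h1.filter_mono nhdsWithin_le_nhds, self_mem_nhdsWithin] with s hs hs0
    have hs0 : s ≠ 0 := hs0
    have a1 := connect (isPreconnected_range (hpath f s)) (hpathS f hfh s hs0)
      ⟨nuij s f, ⟨1, by simp only [scL_one]⟩, hs⟩
    have a2 : nuij s (0 : LCoef n) ∈ U := a1 ⟨0, by simp only [scL_zero]⟩
    have a3 := connect (isPreconnected_range (hpath c s)) (hpathS c hc s hs0)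
      ⟨nuij s 0, ⟨0, by simp only [scL_zero]⟩, a2⟩
    exact a3 ⟨1, by simp only [scL_one]⟩
  have h3 : Filter.Tendsto (fun s : ℝ => nuij s c) (nhdsWithin (0 : ℝ) {0}ᶜ) (nhds c) := by
    have := (hcont c).tendsto 0
    rw [nuij_zero] at this
    exact this.mono_left nhdsWithin_le_nhds
  exact (isClosed_range_Phi n).mem_of_tendsto h3 h2

/-- If `G` is a real homogeneous polynomial of degree `d` in `x, y, t` with `G(0,0,1) = 1`
which divides the base polynomial of `A`, then there is a complex symmetric `d×d` matrix `B`
whose base polynomial is `G`. -/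
theorem exists_symmetric_of_factor {n : ℕ} (A : Matrix (Fin n) (Fin n) ℂ)
    (G : MvPolynomial (Fin 3) ℝ) (d : ℕ)
    (hhom : G.IsHomogeneous d)
    (hnorm : MvPolynomial.eval (![0, 0, 1] : Fin 3 → ℝ) G = 1)
    (hdvd : MvPolynomial.map (algebraMap ℝ ℂ) G ∣ basePolyMv A) :
    ∃ B : Matrix (Fin d) (Fin d) ℂ, Bᵀ = B ∧
      ∀ x y t : ℝ, basePoly B x y t = ((MvPolynomial.eval (![x, y, t]) G : ℝ) : ℂ) := by
  have hmon : MonicHom d G := monicHom_of_eval hhom hnorm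
  have hev : ∀ x y t : ℂ, hev (coefs d G) x y t =
      MvPolynomial.eval ![x, y, t] (MvPolynomial.map (algebraMap ℝ ℂ) G) := by
    intro x y t
    rw [hev_coefs hmon, MvPolynomial.eval_map]
    rfl
  have hhyp : HypC (coefs d G) := by
    intro x y t ht
    rw [hev] at ht
    obtain ⟨Q, hQ⟩ := hdvd
    have h1 : MvPolynomial.eval ![(x : ℂ), (y : ℂ), t] (basePolyMv A) = 0 := by
      rw [hQ, map_mul, ht, zero_mul]
    have h2 : ((x : ℂ) • reM A + (y : ℂ) • imM A + t • (1 : Matrix (Fin n) (Fin n) ℂ)).det = 0 := by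
      rw [← h1, basePolyMv, RingHom.map_det]
      congr 1
      ext i j
      simp [mul_comm]
    refine herm_root ?_ h2
    ext i j
    simp [reM, imM]
    ring
  have hreal : ∀ x y t : ℝ, _root_.hev (coefs d G) (x : ℂ) (y : ℂ) (t : ℂ) =
      ((MvPolynomial.eval (![x, y, t]) G : ℝ) : ℂ) := by
    intro x y t
    rw [hev_ofReal, hev_coefs hmon]
    rfl
  rcases Nat.eq_zero_or_pos d with rfl | hd
  · refine ⟨0, by simp, fun x y t => ?_⟩
    rw [← hreal]
    simp [basePoly, _root_.hev]
  · obtain ⟨e, he⟩ := helton_vinnikov hd hhyp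
    have hDs : ∀ i j, Matrix.diagonal e.1 i j = Matrix.diagonal e.1 j i := fun i j =>
      congrFun (congrFun (Matrix.diagonal_transpose e.1) j) i
    have hSs : ∀ i j, symM e.2 i j = symM e.2 j i := fun i j =>
      congrFun (congrFun (symM_transpose e.2) j) i
    let B : Matrix (Fin d) (Fin d) ℂ := Matrix.of fun i j =>
      ((Matrix.diagonal e.1 i j : ℝ) : ℂ) + Complex.I * ((symM e.2 i j : ℝ) : ℂ)
    have hre : reM B = (Matrix.diagonal e.1).map (algebraMap ℝ ℂ) := by
      ext i j
      simp only [reM, B, Matrix.smul_apply, Matrix.add_apply, Matrix.conjTranspose_apply,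
        Matrix.of_apply, Matrix.map_apply, smul_eq_mul, Complex.coe_algebraMap]
      rw [hDs j i, hSs j i]
      simp
      ring
    have him : imM B = (symM e.2).map (algebraMap ℝ ℂ) := by
      ext i j
      simp only [imM, B, Matrix.smul_apply, Matrix.sub_apply, Matrix.conjTranspose_apply,
        Matrix.of_apply, Matrix.map_apply, smul_eq_mul, Complex.coe_algebraMap]
      rw [hDs j i, hSs j i]
      have hI := Complex.I_ne_zero
      simp only [star_add, star_mul', Complex.star_def, Complex.conj_I, Complex.conj_ofReal]
      field_simp
      ring
    refine ⟨B, ?_, fun x y t => ?_⟩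
    · ext i j
      simp only [B, Matrix.transpose_apply, Matrix.of_apply]
      rw [hDs j i, hSs j i]
    · rw [← hreal, ← he, hev_Phi, basePoly, hre, him]
      rfl
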